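/- Let p > 1 and let X be a random variable following the free Poisson (Marchenko–Pastur) distribution fp(p), i.e., the probability measure on ((√p−1)², (√p+1)²) with density √(((√p+1)² − x)(x − (√p−1)²))/(2πx). Then for every real r with |r| ≥ 1, the law of X^r (the pushforward of fp(p) under x ↦ x^r) belongs to the class UI. -/

import Mathlib

open MeasureTheory Set

/-- The Cauchy transform of a measure on `ℝ`, `G_μ(z) = ∫ (z-x)⁻¹ dμ(x)`. -/
noncomputable def cauchyTransform (μ : Measure ℝ) (z : ℂ) : ℂ :=
  ∫ x : ℝ, (z - (x : ℂ))⁻¹ ∂μ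

/-- The class UI: the right inverse of the Cauchy transform, defined on some triangular
domain `Λ_{γ,δ} = {w ∈ ℂ⁻ : γ|Re w| < -Im w, Im w > -δ}`, has a univalent (injective)
analytic continuation `F` to the whole lower half-plane. -/
def IsUI (μ : Measure ℝ) : Prop :=
  ∃ F : ℂ → ℂ,
    AnalyticOnNhd ℂ F {z : ℂ | z.im < 0} ∧
    Set.InjOn F {z : ℂ | z.im < 0} ∧
    ∃ γ : ℝ, 0 < γ ∧ ∃ δ : ℝ, 0 < δ ∧
      ∀ w : ℂ, γ * |w.re| < -w.im → -δ < w.im →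
        0 < (F w).im ∧ cauchyTransform μ (F w) = w

/-- Density of the free Poisson (Marchenko–Pastur) distribution `fp(p)` for `p ≥ 1`:
`√(((√p+1)² - x)(x - (√p-1)²))/(2πx)` on `((√p-1)², (√p+1)²)`. -/
noncomputable def fpDensity (p : ℝ) (x : ℝ) : ℝ :=
  Real.sqrt (((Real.sqrt p + 1) ^ 2 - x) * (x - (Real.sqrt p - 1) ^ 2)) / (2 * Real.pi * x)

/-- The free Poisson (Marchenko–Pastur) distribution `fp(p)` for `p ≥ 1`. -/
noncomputable def fpMeasure (p : ℝ) : Measure ℝ :=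
  MeasureTheory.volume.withDensity
    (fun x => ENNReal.ofReal
      ((Set.Ioo ((Real.sqrt p - 1) ^ 2) ((Real.sqrt p + 1) ^ 2)).indicator (fpDensity p) x))

open Filter Topology

/-- Near a critical point, a nonconstant holomorphic function takes every nearby noncritical value
at least twice. -/
theorem eventually_exists_ne_of_deriv_eq_zero {f : ℂ → ℂ} {p : ℂ} (hf : AnalyticAt ℂ f p)
    (hnc : ¬ ∀ᶠ z in 𝓝 p, f z = f p) (hd : deriv f p = 0) {N : Set ℂ} (hN : N ∈ 𝓝 p) :
    ∀ᶠ w in 𝓝[≠] (f p), ∃ z₁ ∈ N, ∃ z₂ ∈ N, z₁ ≠ z₂ ∧ f z₁ = w ∧ f z₂ = w := by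
  have hfa : AnalyticAt ℂ (fun z => f z - f p) p := hf.sub analyticAt_const
  obtain ⟨n, g, hg, hgp, hfg⟩ := hfa.exists_eventuallyEq_pow_smul_nonzero_iff.2
    (by simpa only [sub_eq_zero] using hnc)
  have hn0 : n ≠ 0 := by
    rintro rfl
    have := hfg.self_of_nhds
    simp at this
    exact hgp this.symm
  have hn1 : n ≠ 1 := by
    rintro rfl
    have h1 : HasDerivAt (fun z => (z - p) ^ 1 • g z) (g p) p := by
      have h2 : HasDerivAt (fun z => (z - p)) 1 p := (hasDerivAt_id p).sub_const p
      convert! h2.mul hg.differentiableAt.hasDerivAt using 1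
      · ext z; simp
      · simp
    have h3 := (h1.congr_of_eventuallyEq hfg).deriv
    rw [deriv_sub_const, hd] at h3
    exact hgp h3.symm
  obtain ⟨c, hc⟩ := IsAlgClosed.exists_pow_nat_eq (g p) (Nat.pos_of_ne_zero hn0)
  have hc0 : c ≠ 0 := by
    rintro rfl
    rw [zero_pow hn0] at hc
    exact hgp hc.symm
  set r : ℂ → ℂ := fun z => c * (g z / g p) ^ ((n : ℂ)⁻¹)
  have hr : AnalyticAt ℂ r p := by
    refine analyticAt_const.mul (AnalyticAt.cpow (hg.div analyticAt_const hgp) analyticAt_const ?_)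
    simp [div_self hgp]
  have hrn : ∀ z, r z ^ n = g z := by
    intro z
    simp only [r]
    rw [mul_pow, Complex.cpow_nat_inv_pow _ hn0, hc]
    field_simp
  have hrp : r p = c := by simp [r, div_self hgp]
  set ψ : ℂ → ℂ := fun z => (z - p) * r z
  have hψ : AnalyticAt ℂ ψ p := (analyticAt_id.sub analyticAt_const).mul hr
  have hψ' : HasDerivAt ψ c p := by
    have h2 : HasDerivAt (fun z => (z - p)) 1 p := (hasDerivAt_id p).sub_const p
    convert! h2.mul hr.differentiableAt.hasDerivAt using 1
    simp [hrp]
  have hmap : map ψ (𝓝 p) = 𝓝 0 := by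
    have h := (hψ'.deriv ▸ hψ.hasStrictDerivAt).map_nhds_eq hc0
    simpa [ψ] using h
  have hgood : {z | f z - f p = ψ z ^ n} ∩ N ∈ 𝓝 p := by
    refine inter_mem ?_ hN
    filter_upwards [hfg] with z hz
    simp only [ψ, mul_pow, hrn, hz, smul_eq_mul]
  have himg : ψ '' ({z | f z - f p = ψ z ^ n} ∩ N) ∈ 𝓝 (0 : ℂ) := by
    rw [← hmap]; exact image_mem_map hgood
  obtain ⟨δ, hδ, hball⟩ := Metric.mem_nhds_iff.1 himg
  have hω := Complex.isPrimitiveRoot_exp n hn0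
  set ω := Complex.exp (2 * Real.pi * Complex.I / n)
  have hω1 : ω ≠ 1 := hω.ne_one (by omega)
  have hωn : ω ^ n = 1 := hω.pow_eq_one
  have hωnorm : ‖ω‖ = 1 := Complex.norm_eq_one_of_pow_eq_one hωn hn0
  rw [eventually_nhdsWithin_iff]
  filter_upwards [Metric.ball_mem_nhds (f p) (pow_pos hδ n)] with w hw hwne
  obtain ⟨ε, hε⟩ := IsAlgClosed.exists_pow_nat_eq (w - f p) (Nat.pos_of_ne_zero hn0)
  have hε0 : ε ≠ 0 := by
    rintro rfl
    rw [zero_pow hn0] at hε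
    exact hwne (sub_eq_zero.1 hε.symm)
  have hεn : ‖ε‖ < δ := by
    refine lt_of_pow_lt_pow_left₀ n hδ.le ?_
    rw [← norm_pow, hε]
    simpa [dist_eq_norm] using hw
  obtain ⟨z₁, ⟨h1, h1N⟩, hz₁⟩ := hball (show ε ∈ Metric.ball 0 δ by simpa using hεn)
  obtain ⟨z₂, ⟨h2, h2N⟩, hz₂⟩ := hball (show ε * ω ∈ Metric.ball 0 δ by simpa [hωnorm] using hεn)
  refine ⟨z₁, h1N, z₂, h2N, ?_, ?_, ?_⟩
  · rintro rfl
    rw [hz₁] at hz₂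
    exact hω1 (mul_left_cancel₀ hε0 (by rw [mul_one]; exact hz₂.symm))
  · simp only [mem_ofPred_eq, hz₁, hε] at h1
    exact sub_left_injective h1
  · simp only [mem_ofPred_eq, hz₂, mul_pow, hωn, mul_one, hε] at h2
    exact sub_left_injective h2

/-- A nonconstant holomorphic map `H` on a domain `D` which is proper over a connected open set `V`
and takes each value of some nonempty open subset of `V` at most once has a holomorphic inverse
over `V`. -/
theorem exists_analytic_inverse_of_proper {D V O : Set ℂ} {H : ℂ → ℂ} (hD : IsOpen D)
    (hDc : IsPreconnected D) (hH : AnalyticOnNhd ℂ H D) (hV : IsOpen V) (hVc : IsPreconnected V)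
    (hprop : ∀ U : Ultrafilter ℂ, D ∈ U → ∀ w ∈ V, Tendsto H U (𝓝 w) →
      ∃ c ∈ D, (U : Filter ℂ) ≤ 𝓝 c)
    (hO : IsOpen O) (hOV : (V ∩ O).Nonempty)
    (huniq : ∀ z₁ ∈ D, ∀ z₂ ∈ D, H z₁ ∈ O → H z₁ = H z₂ → z₁ = z₂)
    (hnc : ∀ w, ∃ z ∈ D, H z ≠ w) (hne : ∃ z ∈ D, H z ∈ V) :
    ∃ F : ℂ → ℂ, AnalyticOnNhd ℂ F V ∧
      ∀ w ∈ V, F w ∈ D ∧ H (F w) = w ∧ ∀ z ∈ D, H z = w → z = F w := by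
  have hloc : ∀ p ∈ D, ¬ ∀ᶠ z in 𝓝 p, H z = H p := by
    intro p hp h
    obtain ⟨z, hz, hzw⟩ := hnc (H p)
    exact hzw (hH.eqOn_of_preconnected_of_eventuallyEq analyticOnNhd_const hDc hp h hz)
  have hopen : ∀ p ∈ D, ∀ N ∈ 𝓝 p, H '' N ∈ 𝓝 (H p) := fun p hp N hN =>
    ((hH p hp).eventually_constant_or_nhds_le_map_nhds.resolve_left (hloc p hp)) (image_mem_map hN)
  have hlim : ∀ U : Ultrafilter ℂ, D ∈ U → ∀ w ∈ V, Tendsto H U (𝓝 w) →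
      ∃ c ∈ D, (U : Filter ℂ) ≤ 𝓝 c ∧ H c = w := by
    intro U hU w hw hT
    obtain ⟨c, hc, hUc⟩ := hprop U hU w hw hT
    exact ⟨c, hc, hUc, tendsto_nhds_unique ((hH c hc).continuousAt.tendsto.mono_left hUc) hT⟩
  have hsurj : V ⊆ H '' D := by
    refine hVc.subset_of_closure_inter_subset ?_ ?_ ?_
    · rw [isOpen_iff_mem_nhds]
      rintro _ ⟨z, hz, rfl⟩
      exact hopen z hz D (hD.mem_nhds hz)
    · obtain ⟨z, hz, hzV⟩ := hne
      exact ⟨H z, hzV, z, hz, rfl⟩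
    · rintro w ⟨hw, hwV⟩
      have hnb : (comap H (𝓝 w) ⊓ 𝓟 D).NeBot := by
        refine frequently_iff_neBot (p := (· ∈ D)).1 ?_
        rw [frequently_comap]
        exact (mem_closure_iff_frequently.1 hw).mono fun y ⟨z, hz, hzy⟩ => ⟨z, hzy, hz⟩
      obtain ⟨c, hc, -, hcw⟩ := hlim (Ultrafilter.of (comap H (𝓝 w) ⊓ 𝓟 D))
        ((Ultrafilter.of_le _).trans inf_le_right (mem_principal_self D)) w hwV
        (tendsto_comap.mono_left ((Ultrafilter.of_le _).trans inf_le_left))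
      exact ⟨c, hc, hcw⟩
  have hderiv : ∀ p ∈ D, (∃ᶠ w in 𝓝[≠] (H p), ∀ z₁ ∈ D, ∀ z₂ ∈ D, H z₁ = w → H z₂ = w → z₁ = z₂) →
      deriv H p ≠ 0 := by
    intro p hp hfr hd
    obtain ⟨w, hw, z₁, h1, z₂, h2, hne, e1, e2⟩ := (hfr.and_eventually
      (eventually_exists_ne_of_deriv_eq_zero (hH p hp) (hloc p hp) hd (hD.mem_nhds hp))).exists
    exact hne (hw z₁ h1 z₂ h2 e1 e2)
  set u := interior {w | ∀ z₁ ∈ D, ∀ z₂ ∈ D, H z₁ = w → H z₂ = w → z₁ = z₂} with hu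
  have hVu : V ⊆ u := by
    refine hVc.subset_of_closure_inter_subset isOpen_interior ?_ ?_
    · obtain ⟨w, hwV, hwO⟩ := hOV
      refine ⟨w, hwV, mem_interior.2 ⟨O, ?_, hO, hwO⟩⟩
      intro w' hw' z₁ h1 z₂ h2 e1 e2
      exact huniq z₁ h1 z₂ h2 (e1 ▸ hw') (e1.trans e2.symm)
    · rintro w ⟨hw, hwV⟩
      by_contra hwu
      have huw : ∀ z₁ ∈ D, ∀ z₂ ∈ D, H z₁ = w → H z₂ = w → z₁ = z₂ := by
        intro z₁ h1 z₂ h2 e1 e2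
        by_contra hne
        obtain ⟨N₁, N₂, ho1, ho2, hz1, hz2, hdisj⟩ := t2_separation hne
        have hm1 := hopen z₁ h1 _ (inter_mem (hD.mem_nhds h1) (ho1.mem_nhds hz1))
        have hm2 := hopen z₂ h2 _ (inter_mem (hD.mem_nhds h2) (ho2.mem_nhds hz2))
        rw [e1] at hm1
        rw [e2] at hm2
        obtain ⟨w', ⟨⟨a, ⟨haD, haN⟩, ha⟩, ⟨b, ⟨hbD, hbN⟩, hb⟩⟩, hw'⟩ :=
          mem_closure_iff_nhds.1 hw _ (inter_mem hm1 hm2)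
        have := interior_subset hw' a haD b hbD ha hb
        exact disjoint_left.1 hdisj haN (this ▸ hbN)
      obtain ⟨p, hp, hpw⟩ := hsurj hwV
      have hdp : deriv H p ≠ 0 := by
        refine hderiv p hp ?_
        rw [hpw]
        have h1 : ∃ᶠ w' in 𝓝 w, w' ∈ u := mem_closure_iff_frequently.1 hw
        rw [frequently_nhdsWithin_iff]
        exact h1.mono fun w' hw' => ⟨interior_subset hw', fun h => hwu (h ▸ hw')⟩
      have hinj := (hH p hp).hasStrictDerivAt.eventually_left_inverse hdp
      apply hwu
      rw [hu, mem_interior_iff_mem_nhds]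
      by_contra hcon
      have hfr : ∃ᶠ w' in 𝓝 w, ∃ z : ℂ × ℂ, z.1 ∈ D ∧ z.2 ∈ D ∧ H z.1 = w' ∧ H z.2 = w' ∧
          z.1 ≠ z.2 := by
        intro h
        apply hcon
        filter_upwards [h] with w' hw' z₁ h1 z₂ h2 e1 e2
        by_contra hne
        exact hw' ⟨(z₁, z₂), h1, h2, e1, e2, hne⟩
      have hZ : ∀ w', ∃ z : ℂ × ℂ, (∃ z : ℂ × ℂ, z.1 ∈ D ∧ z.2 ∈ D ∧ H z.1 = w' ∧ H z.2 = w' ∧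
          z.1 ≠ z.2) → z.1 ∈ D ∧ z.2 ∈ D ∧ H z.1 = w' ∧ H z.2 = w' ∧ z.1 ≠ z.2 :=
        fun w' => by
          by_cases h : ∃ z : ℂ × ℂ, z.1 ∈ D ∧ z.2 ∈ D ∧ H z.1 = w' ∧ H z.2 = w' ∧ z.1 ≠ z.2
          · exact ⟨h.choose, fun _ => h.choose_spec⟩
          · exact ⟨0, fun h' => absurd h' h⟩
      choose Z hZ using hZ
      have hnb := frequently_iff_neBot.1 hfr
      set U := Ultrafilter.of (𝓝 w ⊓ 𝓟 {w' | ∃ z : ℂ × ℂ, z.1 ∈ D ∧ z.2 ∈ D ∧ H z.1 = w' ∧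
        H z.2 = w' ∧ z.1 ≠ z.2})
      have hUw : (U : Filter ℂ) ≤ 𝓝 w := (Ultrafilter.of_le _).trans inf_le_left
      have hUS : ∀ᶠ w' in (U : Filter ℂ), (Z w').1 ∈ D ∧ (Z w').2 ∈ D ∧ H (Z w').1 = w' ∧
          H (Z w').2 = w' ∧ (Z w').1 ≠ (Z w').2 := by
        have : {w' | ∃ z : ℂ × ℂ, z.1 ∈ D ∧ z.2 ∈ D ∧ H z.1 = w' ∧
          H z.2 = w' ∧ z.1 ≠ z.2} ∈ (U : Filter ℂ) :=
          ((Ultrafilter.of_le _).trans inf_le_right) (mem_principal_self _)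
        filter_upwards [this] with w' hw' using hZ w' hw'
      have key : ∀ Y : ℂ → ℂ, (∀ᶠ w' in (U : Filter ℂ), Y w' ∈ D ∧ H (Y w') = w') →
          Tendsto Y U (𝓝 p) := by
        intro Y hY
        obtain ⟨c, hc, hUc, hcw⟩ := hlim (U.map Y) (hY.mono fun _ h => h.1) w hwV (by
          rw [Ultrafilter.coe_map, tendsto_map'_iff]
          exact (tendsto_id.mono_left hUw).congr' (hY.mono fun _ h => h.2.symm))
        rwa [huw c hc p hp hcw hpw] at hUc
      have k1 := (key (fun w' => (Z w').1) (hUS.mono fun _ h => ⟨h.1, h.2.2.1⟩)).eventually hinj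
      have k2 := (key (fun w' => (Z w').2) (hUS.mono fun _ h => ⟨h.2.1, h.2.2.2.1⟩)).eventually hinj
      obtain ⟨w', ⟨⟨-, -, e1, e2, hne⟩, l1⟩, l2⟩ := ((hUS.and k1).and k2).exists
      exact hne (by rw [← l1, ← l2, e1, e2])
  have hF : ∀ w, ∃ z, w ∈ V → z ∈ D ∧ H z = w := by
    intro w
    by_cases hw : w ∈ V
    · obtain ⟨z, hz, hzw⟩ := hsurj hw
      exact ⟨z, fun _ => ⟨hz, hzw⟩⟩
    · exact ⟨0, fun h => absurd h hw⟩
  choose F hF using hF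
  have hFu : ∀ w ∈ V, ∀ z ∈ D, H z = w → z = F w := fun w hw z hz hzw =>
    interior_subset (hVu hw) z hz (F w) (hF w hw).1 hzw (hF w hw).2
  refine ⟨F, ?_, fun w hw => ⟨(hF w hw).1, (hF w hw).2, hFu w hw⟩⟩
  refine DifferentiableOn.analyticOnNhd (fun w hw => ?_) hV
  obtain ⟨hp, hpw⟩ := hF w hw
  have hdp : deriv H (F w) ≠ 0 := by
    refine hderiv (F w) hp ?_
    rw [hpw]
    refine Eventually.frequently (eventually_nhdsWithin_of_eventually_nhds ?_)
    exact mem_interior_iff_mem_nhds.1 (hVu hw)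
  have hs := (hH _ hp).hasStrictDerivAt
  have h1 := hs.to_localInverse hdp
  have h2 := hs.eventually_right_inverse hdp
  have h3 := h1.hasDerivAt.continuousAt.tendsto.eventually
    (p := fun z => z ∈ D) (by
      refine hD.mem_nhds ?_
      have := (hs.hasStrictFDerivAt_equiv hdp).localInverse_apply_image
      exact mem_of_eq_of_mem this hp)
  rw [hpw] at h1 h2 h3
  refine (h1.hasDerivAt.differentiableAt.congr_of_eventuallyEq ?_).differentiableWithinAt
  filter_upwards [h2, h3, hV.mem_nhds hw] with w' h2 h3 h4
  exact (hFu w' h4 _ h3 h2).symm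

/-- Differentiability of parametric integrals of locally bounded holomorphic functions. -/
theorem differentiableOn_integral_of_locally_bounded {X : Type*} [MeasurableSpace X]
    {μ : Measure X} [IsFiniteMeasure μ]
    {U : Set ℂ} (hU : IsOpen U) {k : ℂ → X → ℂ} (hm : ∀ z ∈ U, AEStronglyMeasurable (k z) μ)
    (hd : ∀ᵐ y ∂μ, DifferentiableOn ℂ (fun z => k z y) U)
    (hb : ∀ z₀ ∈ U, ∃ ε > 0, ∃ M : ℝ, ∀ᵐ y ∂μ, ∀ z ∈ Metric.ball z₀ ε, z ∈ U → ‖k z y‖ ≤ M) :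
    DifferentiableOn ℂ (fun z => ∫ y, k z y ∂μ) U := by
  intro z₀ hz₀
  obtain ⟨ε₁, hε₁, M, hM⟩ := hb z₀ hz₀
  obtain ⟨ε₂, hε₂, hball⟩ := Metric.isOpen_iff.1 hU z₀ hz₀
  set ε := min ε₁ ε₂
  have hε : 0 < ε := lt_min hε₁ hε₂
  have hsub : ∀ z ∈ Metric.ball z₀ ε, z ∈ U := fun z hz =>
    hball (Metric.ball_subset_ball (min_le_right _ _) hz)
  have hbd : ∀ᵐ y ∂μ, ∀ z ∈ Metric.ball z₀ ε, ‖k z y‖ ≤ M := by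
    filter_upwards [hM] with y hy z hz
    exact hy z (Metric.ball_subset_ball (min_le_left _ _) hz) (hsub z hz)
  have hz₀U := hU.mem_nhds hz₀
  have hmeas' : AEStronglyMeasurable (fun y => deriv (fun z => k z y) z₀) μ := by
    set u : ℕ → ℂ := fun n => z₀ + ((ε / 2 / (n + 1) : ℝ) : ℂ)
    have hu0 : Tendsto (fun n : ℕ => ((ε / 2 / (n + 1) : ℝ) : ℂ)) atTop (𝓝 0) := by
      have h1 : Tendsto (fun n : ℕ => (ε / 2 / (n + 1) : ℝ)) atTop (𝓝 0) := by
        have := (tendsto_one_div_add_atTop_nhds_zero_nat (𝕜 := ℝ)).const_mul (ε / 2)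
        simpa only [mul_one_div, mul_zero] using this
      exact_mod_cast (Complex.continuous_ofReal.tendsto 0).comp h1
    have hu : Tendsto u atTop (𝓝[≠] z₀) := by
      refine tendsto_nhdsWithin_iff.2 ⟨by have := hu0.const_add z₀; rwa [add_zero] at this, ?_⟩
      refine Eventually.of_forall fun n => ?_
      have : (ε / 2 / (n + 1) : ℝ) ≠ 0 := by positivity
      have h2 : ((ε / 2 / (n + 1) : ℝ) : ℂ) ≠ 0 := Complex.ofReal_ne_zero.2 this
      simpa [u] using h2
    have huU : ∀ n, u n ∈ U := by
      intro n
      apply hsub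
      rw [Metric.mem_ball, dist_eq_norm]
      simp only [u, add_sub_cancel_left, Complex.norm_real, Real.norm_eq_abs]
      rw [abs_of_pos (by positivity)]
      have : ε / 2 / (n + 1) ≤ ε / 2 := div_le_self (by positivity) (by simp)
      linarith
    refine aestronglyMeasurable_of_tendsto_ae (f := fun n y => slope (fun z => k z y) z₀ (u n))
      atTop (fun n => ?_) ?_
    · simp only [slope_def_field]
      exact ((hm _ (huU n)).sub (hm _ hz₀)).div₀ aestronglyMeasurable_const
    · filter_upwards [hd] with y hy
      exact (hasDerivAt_iff_tendsto_slope.1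
        ((hy z₀ hz₀).differentiableAt hz₀U).hasDerivAt).comp hu
  have key := hasDerivAt_integral_of_dominated_loc_of_deriv_le (μ := μ) (F := k)
    (F' := fun z y => deriv (fun z => k z y) z) (bound := fun _ => M / (ε / 4))
    (x₀ := z₀) (s := Metric.ball z₀ (ε / 2)) (Metric.ball_mem_nhds _ (by positivity))
    (by filter_upwards [hz₀U] with z hz using hm z hz)
    (Integrable.of_bound (hm z₀ hz₀) M (by
      filter_upwards [hbd] with y hy using hy z₀ (Metric.mem_ball_self hε)))
    hmeas' ?_ (integrable_const _) ?_
  · exact key.2.differentiableAt.differentiableWithinAt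
  · filter_upwards [hd, hbd] with y hy hyb z hz
    have hcb : Metric.closedBall z (ε / 4) ⊆ Metric.ball z₀ ε := by
      intro x hx
      rw [Metric.mem_closedBall] at hx
      rw [Metric.mem_ball] at hz ⊢
      linarith [dist_triangle x z z₀]
    refine Complex.norm_deriv_le_of_forall_mem_sphere_norm_le (by positivity) ?_ ?_
    · refine DifferentiableOn.diffContOnCl ?_
      rw [closure_ball _ (by positivity)]
      exact hy.mono fun x hx => hsub x (hcb hx)
    · exact fun x hx => hyb x (hcb (Metric.sphere_subset_closedBall hx))
  · filter_upwards [hd] with y hy z hz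
    exact ((hy z (hsub z (Metric.ball_subset_ball (by linarith) hz))).differentiableAt
      (hU.mem_nhds (hsub z (Metric.ball_subset_ball (by linarith) hz)))).hasDerivAt

/-- The Cauchy transform of the density `g` on the interval `(α, β)`. -/
noncomputable def densityTransform (g : ℝ → ℝ) (α β : ℝ) (z : ℂ) : ℂ :=
  ∫ y in Ioo α β, (g y : ℂ) / (z - y)

section Density

variable {g : ℝ → ℝ} {α β : ℝ}

theorem aestronglyMeasurable_density (hc : ContinuousOn g (Icc α β)) :
    AEStronglyMeasurable (fun y => (g y : ℂ)) (volume.restrict (Ioo α β)) :=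
  (Complex.continuous_ofReal.comp_continuousOn
    (hc.mono Ioo_subset_Icc_self)).aestronglyMeasurable measurableSet_Ioo

theorem aestronglyMeasurable_density_div (hc : ContinuousOn g (Icc α β)) (z : ℂ) :
    AEStronglyMeasurable (fun y : ℝ => (g y : ℂ) / (z - y)) (volume.restrict (Ioo α β)) := by
  have : Measurable fun y : ℝ => z - (y : ℂ) := by fun_prop
  exact (aestronglyMeasurable_density hc).div₀ this.aestronglyMeasurable

theorem exists_density_bound (hc : ContinuousOn g (Icc α β)) :
    ∃ M, 0 < M ∧ ∀ y ∈ Icc α β, |g y| ≤ M := by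
  obtain ⟨M, hM⟩ := isCompact_Icc.exists_bound_of_continuousOn hc
  exact ⟨max M 1, by positivity, fun y hy => (hM y hy).trans (le_max_left _ _)⟩

theorem norm_density_div_le {M d : ℝ} (hM : ∀ y ∈ Icc α β, |g y| ≤ M) (hd : 0 < d) {z : ℂ}
    (hz : ∀ y ∈ Ioo α β, d ≤ ‖z - (y : ℂ)‖) {y : ℝ} (hy : y ∈ Ioo α β) :
    ‖(g y : ℂ) / (z - y)‖ ≤ M / d := by
  rw [norm_div, Complex.norm_real]
  have h1 := hM y (Ioo_subset_Icc_self hy)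
  exact div_le_div₀ ((abs_nonneg _).trans h1) h1 hd (hz y hy)

theorem abs_im_le_norm_sub_ofReal (z : ℂ) (y : ℝ) : |z.im| ≤ ‖z - (y : ℂ)‖ := by
  simpa using Complex.abs_im_le_norm (z - (y : ℂ))

theorem integrable_density_div (hc : ContinuousOn g (Icc α β)) {z : ℂ} (hz : z.im ≠ 0) :
    Integrable (fun y : ℝ => (g y : ℂ) / (z - y)) (volume.restrict (Ioo α β)) := by
  obtain ⟨M, -, hM⟩ := exists_density_bound hc
  refine Integrable.of_bound (aestronglyMeasurable_density_div hc z) (M / |z.im|) ?_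
  filter_upwards [ae_restrict_mem measurableSet_Ioo] with y hy
  exact norm_density_div_le hM (abs_pos.2 hz) (fun y _ => abs_im_le_norm_sub_ofReal z y) hy

theorem densityTransform_norm_le {M d : ℝ} (hαβ : α ≤ β) (hM : ∀ y ∈ Icc α β, |g y| ≤ M)
    (hd : 0 < d) {z : ℂ} (hz : ∀ y ∈ Ioo α β, d ≤ ‖z - (y : ℂ)‖) :
    ‖densityTransform g α β z‖ ≤ M / d * (β - α) := by
  have := norm_setIntegral_le_of_norm_le_const (μ := volume) (s := Ioo α β) (by simp)
    (fun y hy => norm_density_div_le hM hd hz hy)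
  simpa [hαβ, densityTransform] using this

theorem im_ofReal_div_sub (a : ℝ) (z : ℂ) (y : ℝ) :
    ((a : ℂ) / (z - y)).im = -(a * (z.im / ((z.re - y) ^ 2 + z.im ^ 2))) := by
  rw [Complex.div_im, Complex.normSq_apply]
  simp
  ring

theorem densityTransform_im (hc : ContinuousOn g (Icc α β)) {z : ℂ} (hz : z.im ≠ 0) :
    (densityTransform g α β z).im =
      -∫ y in Ioo α β, g y * (z.im / ((z.re - y) ^ 2 + z.im ^ 2)) := by
  have h := integral_im (integrable_density_div hc hz)
  rw [densityTransform]
  simp only [RCLike.im_to_complex] at h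
  rw [← h, ← integral_neg]
  simp only [im_ofReal_div_sub]

theorem integrable_density_poisson (hc : ContinuousOn g (Icc α β)) {z : ℂ} (hz : z.im ≠ 0) :
    Integrable (fun y => g y * (z.im / ((z.re - y) ^ 2 + z.im ^ 2)))
      (volume.restrict (Ioo α β)) := by
  have h := (integrable_density_div hc hz).im.neg
  refine h.congr (Eventually.of_forall fun y => ?_)
  simp [im_ofReal_div_sub]

theorem densityTransform_im_neg (hαβ : α < β) (hc : ContinuousOn g (Icc α β))
    (hg : ∀ y ∈ Ioo α β, 0 < g y) {z : ℂ} (hz : 0 < z.im) :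
    (densityTransform g α β z).im < 0 := by
  rw [densityTransform_im hc hz.ne', neg_neg_iff_pos]
  rw [setIntegral_pos_iff_support_of_nonneg_ae]
  · refine lt_of_lt_of_le (b := volume (Ioo α β)) (by simpa using hαβ) (measure_mono ?_)
    intro y hy
    have := hg y hy
    exact ⟨(by positivity : 0 < g y * (z.im / ((z.re - y) ^ 2 + z.im ^ 2))).ne', hy⟩
  · filter_upwards [ae_restrict_mem measurableSet_Ioo] with y hy
    have := hg y hy
    simp only [Pi.zero_apply]
    positivity
  · exact integrable_density_poisson hc hz.ne'

theorem densityTransform_im_nonneg (hc : ContinuousOn g (Icc α β))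
    (hg : ∀ y ∈ Ioo α β, 0 < g y) {z : ℂ} (hz : z.im < 0) :
    0 ≤ (densityTransform g α β z).im := by
  rw [densityTransform_im hc hz.ne, neg_nonneg]
  refine setIntegral_nonpos measurableSet_Ioo fun y hy => ?_
  have := hg y hy
  exact mul_nonpos_of_nonneg_of_nonpos this.le
    (div_nonpos_of_nonpos_of_nonneg hz.le (by positivity))

theorem integral_poisson {x η : ℝ} (hη : 0 < η) :
    Integrable (fun y : ℝ => η / ((x - y) ^ 2 + η ^ 2)) ∧
      ∫ y : ℝ, η / ((x - y) ^ 2 + η ^ 2) = Real.pi := by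
  have e : (fun y : ℝ => η / ((x - y) ^ 2 + η ^ 2)) =
      fun y => η⁻¹ * (1 + ((y - x) * η⁻¹) ^ 2)⁻¹ := by
    ext y
    field_simp
    ring
  have h0 : Integrable (fun y : ℝ => (1 + (y * η⁻¹) ^ 2)⁻¹) :=
    integrable_inv_one_add_sq.comp_mul_right' (inv_ne_zero hη.ne')
  rw [e]
  refine ⟨(h0.comp_sub_right x).const_mul _, ?_⟩
  rw [integral_const_mul, integral_sub_right_eq_self (fun y : ℝ => (1 + (y * η⁻¹) ^ 2)⁻¹) x,
    Measure.integral_comp_mul_right (fun y : ℝ => (1 + y ^ 2)⁻¹), integral_univ_inv_one_add_sq]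
  simp [abs_of_pos hη]
  field_simp

theorem densityTransform_im_ge (hαβ : α ≤ β) (hc : ContinuousOn g (Icc α β)) {ε K c : ℝ}
    (hε : 0 ≤ ε) (hK : 0 ≤ K) (hb : ∀ y ∈ Ioo α β, g y ≤ ε + K * (y - c) ^ 2)
    {z : ℂ} (hz : 0 < z.im) :
    -(Real.pi * (ε + 2 * K * (z.re - c) ^ 2) + 2 * K * z.im * (β - α)) ≤
      (densityTransform g α β z).im := by
  rw [densityTransform_im hc hz.ne', neg_le_neg_iff]
  obtain ⟨hI, hpi⟩ := integral_poisson (x := z.re) hz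
  have hI2 : Integrable (fun y => (ε + 2 * K * (z.re - c) ^ 2) *
      (z.im / ((z.re - y) ^ 2 + z.im ^ 2))) (volume.restrict (Ioo α β)) :=
    (hI.const_mul _).integrableOn
  have hI3 : Integrable (fun _ : ℝ => 2 * K * z.im) (volume.restrict (Ioo α β)) :=
    integrable_const _
  calc ∫ y in Ioo α β, g y * (z.im / ((z.re - y) ^ 2 + z.im ^ 2))
      ≤ ∫ y in Ioo α β, ((ε + 2 * K * (z.re - c) ^ 2) *
          (z.im / ((z.re - y) ^ 2 + z.im ^ 2)) + 2 * K * z.im) := by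
        refine setIntegral_mono_on (integrable_density_poisson hc hz.ne') (hI2.add hI3)
          measurableSet_Ioo fun y hy => ?_
        have h1 := hb y hy
        have hP : 0 < (z.re - y) ^ 2 + z.im ^ 2 := by positivity
        have h2 : g y ≤ (ε + 2 * K * (z.re - c) ^ 2) + 2 * K * ((z.re - y) ^ 2 + z.im ^ 2) := by
          nlinarith [mul_nonneg hK (sq_nonneg ((y - z.re) - (z.re - c))),
            mul_nonneg hK (sq_nonneg z.im)]
        calc g y * (z.im / ((z.re - y) ^ 2 + z.im ^ 2))
            ≤ ((ε + 2 * K * (z.re - c) ^ 2) + 2 * K * ((z.re - y) ^ 2 + z.im ^ 2)) *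
              (z.im / ((z.re - y) ^ 2 + z.im ^ 2)) := by gcongr
          _ = _ := by field_simp
    _ = (ε + 2 * K * (z.re - c) ^ 2) * (∫ y in Ioo α β, z.im / ((z.re - y) ^ 2 + z.im ^ 2)) +
          2 * K * z.im * (β - α) := by
        rw [integral_add hI2 hI3, integral_const_mul]
        simp [hαβ]
        ring
    _ ≤ _ := by
        have h3 : ∫ y in Ioo α β, z.im / ((z.re - y) ^ 2 + z.im ^ 2) ≤ Real.pi := by
          rw [← hpi]
          exact setIntegral_le_integral hI (Eventually.of_forall fun y => by
            simp only [Pi.zero_apply]; positivity)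
        have : 0 ≤ ε + 2 * K * (z.re - c) ^ 2 := by positivity
        nlinarith

/-- If the density vanishes at a point `c` outside `(α, β)`, then the imaginary part of its Cauchy
transform has limit zero at `c` from the upper half-plane. -/
theorem eventually_densityTransform_im_ge (hαβ : α ≤ β) (hc : ContinuousOn g (Icc α β))
    {c : ℝ} (hcI : c ∈ Icc α β → g c = 0) {ε : ℝ} (hε : 0 < ε) :
    ∀ᶠ z : ℂ in 𝓝 (c : ℂ), 0 < z.im → -ε ≤ (densityTransform g α β z).im := by
  obtain ⟨M, hM0, hM⟩ := exists_density_bound hc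
  set ε' := ε / (2 * Real.pi)
  have hε' : 0 < ε' := by positivity
  have hev : ∀ᶠ y in 𝓝[Icc α β] c, g y < ε' := by
    by_cases h : c ∈ Icc α β
    · have := hc c h
      rw [ContinuousWithinAt, hcI h] at this
      exact this.eventually_lt_const hε'
    · filter_upwards [mem_nhdsWithin_of_mem_nhds (isClosed_Icc.isOpen_compl.mem_nhds h),
        self_mem_nhdsWithin] with y h1 h2
      exact absurd h2 h1
  obtain ⟨δ, hδ, hδ'⟩ := Metric.mem_nhdsWithin_iff.1 hev
  set K := M / δ ^ 2
  have hK : 0 ≤ K := by positivity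
  have hb : ∀ y ∈ Ioo α β, g y ≤ ε' + K * (y - c) ^ 2 := by
    intro y hy
    have hy' := Ioo_subset_Icc_self hy
    by_cases h : |y - c| < δ
    · have h1 : g y < ε' := hδ' ⟨by simpa [Real.dist_eq] using h, hy'⟩
      have : 0 ≤ K * (y - c) ^ 2 := by positivity
      linarith
    · have h1 : δ ^ 2 ≤ (y - c) ^ 2 := by
        rw [← sq_abs (y - c)]
        exact pow_le_pow_left₀ hδ.le (not_lt.1 h) 2
      have h2 : M ≤ K * (y - c) ^ 2 := by
        calc M = K * δ ^ 2 := by simp only [K]; field_simp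
          _ ≤ _ := by gcongr
      linarith [le_of_abs_le (hM y hy')]
  have hcont : Continuous fun z : ℂ =>
      -(Real.pi * (ε' + 2 * K * (z.re - c) ^ 2) + 2 * K * z.im * (β - α)) := by fun_prop
  have hlim := hcont.tendsto (c : ℂ)
  have hval : -ε < -(Real.pi * (ε' + 2 * K * ((c : ℂ).re - c) ^ 2) +
      2 * K * (c : ℂ).im * (β - α)) := by
    simp only [Complex.ofReal_re, sub_self, Complex.ofReal_im, ε']
    have hpi := Real.pi_pos
    have : Real.pi * (ε / (2 * Real.pi)) = ε / 2 := by field_simp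
    simp only [ne_eq, OfNat.ofNat_ne_zero, not_false_eq_true, zero_pow, mul_zero, add_zero,
      zero_mul, this]
    linarith
  filter_upwards [hlim.eventually_const_lt hval] with z hz hzim
  exact hz.le.trans (densityTransform_im_ge hαβ hc hε'.le hK hb hzim)

theorem differentiableOn_densityTransform (hα : 0 < α) (hc : ContinuousOn g (Icc α β)) :
    DifferentiableOn ℂ (densityTransform g α β) (Metric.ball 0 α) := by
  obtain ⟨M, hM0, hM⟩ := exists_density_bound hc
  refine differentiableOn_integral_of_locally_bounded Metric.isOpen_ball
    (fun z _ => aestronglyMeasurable_density_div hc z) ?_ ?_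
  · filter_upwards [ae_restrict_mem measurableSet_Ioo] with y hy
    refine DifferentiableOn.div (by fun_prop) (by fun_prop) fun z hz h => ?_
    rw [sub_eq_zero] at h
    rw [h, mem_ball_zero_iff, Complex.norm_real, Real.norm_eq_abs] at hz
    linarith [le_abs_self y, hy.1]
  · intro z₀ hz₀
    rw [mem_ball_zero_iff] at hz₀
    refine ⟨(α - ‖z₀‖) / 2, by linarith, M / ((α - ‖z₀‖) / 2), ?_⟩
    filter_upwards [ae_restrict_mem measurableSet_Ioo] with y hy z hz _
    refine norm_density_div_le hM (by linarith) (fun y hy => ?_) hy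
    rw [mem_ball_iff_norm] at hz
    have h1 : ‖z‖ ≤ ‖z - z₀‖ + ‖z₀‖ := by simpa using norm_add_le (z - z₀) z₀
    have h2 : ‖(y : ℂ)‖ - ‖z‖ ≤ ‖z - (y : ℂ)‖ := by
      rw [norm_sub_rev]; exact norm_sub_norm_le _ _
    rw [Complex.norm_real, Real.norm_eq_abs, abs_of_pos (hα.trans hy.1)] at h2
    linarith [hy.1]

/-- The Cauchy transform of a density supported in `(0, ∞)` takes in the upper half-plane all
small values in the lower half-plane. -/
theorem exists_densityTransform_eq (hα : 0 < α) (hαβ : α < β) (hc : ContinuousOn g (Icc α β))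
    (hg : ∀ y ∈ Ioo α β, 0 < g y) :
    ∃ δ > 0, ∀ w : ℂ, ‖w‖ < δ → w.im < 0 → ∃ z : ℂ, 0 < z.im ∧ densityTransform g α β z = w := by
  obtain ⟨M, hM0, hM⟩ := exists_density_bound hc
  have hβ : 0 < β := hα.trans hαβ
  set G : ℂ → ℂ := fun ξ => ∫ y in Ioo α β, (g y : ℂ) * (ξ / (1 - ξ * y))
  have hlow : ∀ ξ ∈ Metric.ball (0 : ℂ) (1 / (2 * β)), ∀ y ∈ Ioo α β,
      1 / 2 ≤ ‖1 - ξ * (y : ℂ)‖ := by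
    intro ξ hξ y hy
    have h1 : ‖(1 : ℂ)‖ - ‖ξ * (y : ℂ)‖ ≤ ‖1 - ξ * (y : ℂ)‖ := norm_sub_norm_le _ _
    rw [mem_ball_zero_iff, lt_div_iff₀ (by positivity)] at hξ
    rw [norm_mul, Complex.norm_real, Real.norm_eq_abs, abs_of_pos (hα.trans hy.1), norm_one] at h1
    have : ‖ξ‖ * y ≤ ‖ξ‖ * β := by gcongr; exact hy.2.le
    linarith
  have hGd : DifferentiableOn ℂ G (Metric.ball 0 (1 / (2 * β))) := by
    refine differentiableOn_integral_of_locally_bounded Metric.isOpen_ball (fun ξ _ => ?_) ?_ ?_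
    · have : Measurable fun y : ℝ => ξ / (1 - ξ * (y : ℂ)) := by fun_prop
      exact (aestronglyMeasurable_density hc).mul this.aestronglyMeasurable
    · filter_upwards [ae_restrict_mem measurableSet_Ioo] with y hy
      refine (differentiableOn_const _).mul
        (DifferentiableOn.div (by fun_prop) (by fun_prop) fun ξ hξ h => ?_)
      have := hlow ξ hξ y hy
      rw [h, norm_zero] at this
      linarith
    · intro z₀ hz₀
      refine ⟨1, one_pos, M * (1 / (2 * β) / (1 / 2)), ?_⟩
      filter_upwards [ae_restrict_mem measurableSet_Ioo] with y hy ξ _ hξ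
      rw [norm_mul, norm_div, Complex.norm_real, Real.norm_eq_abs]
      have h1 := hM y (Ioo_subset_Icc_self hy)
      have h2 := hlow ξ hξ y hy
      rw [mem_ball_zero_iff] at hξ
      gcongr
  have hG0 : G 0 = 0 := by simp [G]
  have hGG : ∀ ξ : ℂ, ξ ≠ 0 → G ξ = densityTransform g α β ξ⁻¹ := by
    intro ξ hξ
    refine integral_congr_ae (Eventually.of_forall fun y => ?_)
    have h : ξ⁻¹ - y = (1 - ξ * y) / ξ := by field_simp
    simp only
    rw [h, div_div_eq_mul_div, mul_div_assoc]
  have hGan : AnalyticAt ℂ G 0 := hGd.analyticAt (Metric.ball_mem_nhds _ (by positivity))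
  have hopen : 𝓝 (0 : ℂ) ≤ map G (𝓝 0) := by
    have := hGan.eventually_constant_or_nhds_le_map_nhds
    rw [hG0] at this
    refine this.resolve_left fun h => ?_
    have hT : Tendsto (fun t : ℝ => -(t : ℂ) * Complex.I) (𝓝[>] 0) (𝓝 0) := by
      have : Continuous fun t : ℝ => -(t : ℂ) * Complex.I := by fun_prop
      simpa using (this.tendsto 0).mono_left nhdsWithin_le_nhds
    obtain ⟨t, ht, ht0⟩ := ((hT.eventually h).and self_mem_nhdsWithin).exists
    have ht0 : 0 < t := ht0
    have hne : -(t : ℂ) * Complex.I ≠ 0 := by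
      simp [ht0.ne']
    have him : 0 < (-(t : ℂ) * Complex.I)⁻¹.im := by
      rw [Complex.inv_im]
      simp
      positivity
    have := densityTransform_im_neg hαβ hc hg him
    rw [← hGG _ hne, ht] at this
    simp at this
  have himg := hopen (image_mem_map (Metric.ball_mem_nhds (0 : ℂ) one_pos))
  obtain ⟨δ, hδ, hball⟩ := Metric.mem_nhds_iff.1 himg
  refine ⟨δ, hδ, fun w hw hwim => ?_⟩
  obtain ⟨ξ, -, rfl⟩ := hball (mem_ball_zero_iff.2 hw)
  have hξ0 : ξ ≠ 0 := by
    rintro rfl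
    simp [hG0] at hwim
  refine ⟨ξ⁻¹, ?_, (hGG ξ hξ0).symm⟩
  rw [hGG ξ hξ0] at hwim
  by_contra! h
  rcases h.lt_or_eq with h | h
  · exact hwim.not_ge (densityTransform_im_nonneg hc hg h)
  · have hr : ξ⁻¹ = ((ξ⁻¹.re : ℝ) : ℂ) := Complex.ext (by simp) (by simpa using h)
    rw [hr, densityTransform] at hwim
    have : ∀ y : ℝ, (g y : ℂ) / (((ξ⁻¹.re : ℝ) : ℂ) - y) = ((g y / (ξ⁻¹.re - y) : ℝ) : ℂ) := by
      intro y; push_cast; rfl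
    simp only [this, integral_complex_ofReal, Complex.ofReal_im, lt_self_iff_false] at hwim

end Density

/-- The plane slit along `(-∞, α] ∪ [β, ∞)`. -/
def doubleSlitPlane (α β : ℝ) : Set ℂ := {z | z.im ≠ 0 ∨ (α < z.re ∧ z.re < β)}

theorem isOpen_doubleSlitPlane (α β : ℝ) : IsOpen (doubleSlitPlane α β) :=
  (isOpen_ne_fun Complex.continuous_im continuous_const).union
    ((isOpen_lt continuous_const Complex.continuous_re).inter
      (isOpen_lt Complex.continuous_re continuous_const))

theorem ofReal_mem_doubleSlitPlane {α β y : ℝ} (hy : y ∈ Ioo α β) :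
    (y : ℂ) ∈ doubleSlitPlane α β := Or.inr (by simpa using hy)

theorem sub_mem_slitPlane_of_mem {α β : ℝ} {z : ℂ} (hz : z ∈ doubleSlitPlane α β) :
    z - α ∈ Complex.slitPlane := by
  rw [Complex.mem_slitPlane_iff]
  rcases hz with h | h
  · right; simpa using h
  · left; simpa using h.1

theorem sub_mem_slitPlane_of_mem' {α β : ℝ} {z : ℂ} (hz : z ∈ doubleSlitPlane α β) :
    β - z ∈ Complex.slitPlane := by
  rw [Complex.mem_slitPlane_iff]
  rcases hz with h | h
  · right; simpa using h
  · left; simpa using h.2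

theorem integral_inv_sub {α β : ℝ} (hαβ : α ≤ β) {z : ℂ} (hz : z.im ≠ 0) :
    ∫ y in Ioo α β, (z - (y : ℂ))⁻¹ = Complex.log (z - α) - Complex.log (z - β) := by
  have hne : ∀ y : ℝ, z - (y : ℂ) ∈ Complex.slitPlane := fun y =>
    Complex.mem_slitPlane_iff.2 (Or.inr (by simpa using hz))
  rw [← integral_Ioc_eq_integral_Ioo, ← intervalIntegral.integral_of_le hαβ]
  rw [intervalIntegral.integral_eq_sub_of_hasDerivAt
    (f := fun y : ℝ => -Complex.log (z - (y : ℂ)))]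
  · ring
  · intro y _
    have h1 : HasDerivAt (fun y : ℝ => z - (y : ℂ)) (-1) y := by
      simpa using (Complex.ofRealCLM.hasDerivAt (x := y)).const_sub z
    convert! (h1.clog_real (hne y)).neg using 1
    rw [neg_div, neg_neg, one_div]
  · refine ContinuousOn.intervalIntegrable fun y _ => ?_
    have hc : Continuous fun y : ℝ => z - (y : ℂ) := by fun_prop
    exact (hc.continuousAt.inv₀ (Complex.slitPlane_ne_zero (hne y))).continuousWithinAt

theorem exists_forall_norm_dslope_le {Ω : Set ℂ} (hΩ : IsOpen Ω) {f : ℂ → ℂ}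
    (hf : DifferentiableOn ℂ f Ω) {z₀ : ℂ} (hz₀ : z₀ ∈ Ω) :
    ∃ ε > 0, ∃ K : ℝ, 0 ≤ K ∧ ∀ z ∈ Metric.ball z₀ (ε / 2), ‖f z‖ ≤ K ∧
      ∀ y ∈ Metric.ball z₀ ε, ‖dslope f y z‖ ≤ K := by
  obtain ⟨ε, hε, hsub⟩ := Metric.nhds_basis_closedBall.mem_iff.1 (hΩ.mem_nhds hz₀)
  have hcomp : IsCompact (Metric.closedBall z₀ ε) := isCompact_closedBall _ _
  obtain ⟨K₁, hK₁⟩ := hcomp.exists_bound_of_continuousOn (hf.continuousOn.mono hsub)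
  obtain ⟨K₂, hK₂⟩ := hcomp.exists_bound_of_continuousOn
    ((hf.deriv hΩ).continuousOn.mono hsub)
  refine ⟨ε, hε, max K₁ (max K₂ 0), le_max_of_le_right (le_max_right _ _), fun z hz =>
    ⟨(hK₁ z ?_).trans (le_max_left _ _), fun y hy => ?_⟩⟩
  · exact Metric.ball_subset_closedBall (Metric.ball_subset_ball (by linarith) hz)
  have hz' : z ∈ Metric.ball z₀ ε := Metric.ball_subset_ball (by linarith) hz
  refine le_trans ?_ ((le_max_left K₂ 0).trans (le_max_right _ _))
  rcases eq_or_ne z y with rfl | hne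
  · rw [dslope_same]
    exact hK₂ z (Metric.ball_subset_closedBall hz')
  · rw [dslope_of_ne _ hne, slope_def_field, norm_div,
      div_le_iff₀ (norm_pos_iff.2 (sub_ne_zero.2 hne))]
    refine (convex_ball z₀ ε).norm_image_sub_le_of_norm_deriv_le (fun x hx => ?_) (fun x hx => ?_)
      hy hz'
    · exact (hf x (hsub (Metric.ball_subset_closedBall hx))).differentiableAt
        (hΩ.mem_nhds (hsub (Metric.ball_subset_closedBall hx)))
    · exact hK₂ x (Metric.ball_subset_closedBall hx)

section Continuation

variable {g : ℝ → ℝ} {α β : ℝ} {ρ : ℂ → ℂ}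

theorem differentiableOn_integral_dslope (hc : ContinuousOn g (Icc α β))
    (hρ : DifferentiableOn ℂ ρ (doubleSlitPlane α β))
    (hρg : ∀ y ∈ Ioo α β, ρ (y : ℂ) = g y) :
    DifferentiableOn ℂ (fun z => ∫ y in Ioo α β, dslope ρ (y : ℂ) z) (doubleSlitPlane α β) := by
  obtain ⟨M, hM0, hM⟩ := exists_density_bound hc
  refine differentiableOn_integral_of_locally_bounded (isOpen_doubleSlitPlane α β)
    (fun z _ => ?_) ?_ ?_
  · have hm : Measurable fun y : ℝ => z - (y : ℂ) := by fun_prop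
    refine AEStronglyMeasurable.congr (f := fun y : ℝ => (ρ z - g y) / (z - y))
      ((aestronglyMeasurable_const.sub (aestronglyMeasurable_density hc)).div₀
        hm.aestronglyMeasurable) ?_
    have hne : ∀ᵐ y : ℝ ∂(volume.restrict (Ioo α β)), y ≠ z.re :=
      ae_restrict_of_ae (Measure.ae_ne volume _)
    filter_upwards [ae_restrict_mem measurableSet_Ioo, hne] with y hy hyz
    have : z ≠ (y : ℂ) := by rintro rfl; simp at hyz
    rw [dslope_of_ne _ this, slope_def_field, hρg y hy]
  · filter_upwards [ae_restrict_mem measurableSet_Ioo] with y hy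
    exact (Complex.differentiableOn_dslope
      ((isOpen_doubleSlitPlane α β).mem_nhds (ofReal_mem_doubleSlitPlane hy))).2 hρ
  · intro z₀ hz₀
    obtain ⟨ε, hε, K, hK0, hK⟩ :=
      exists_forall_norm_dslope_le (isOpen_doubleSlitPlane α β) hρ hz₀
    refine ⟨ε / 2, by positivity, max K ((K + M) / (ε / 2)), ?_⟩
    filter_upwards [ae_restrict_mem measurableSet_Ioo] with y hy z hz _
    by_cases hyb : (y : ℂ) ∈ Metric.ball z₀ ε
    · exact ((hK z hz).2 y hyb).trans (le_max_left _ _)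
    · refine le_trans ?_ (le_max_right _ _)
      have h1 : ε / 2 ≤ ‖z - (y : ℂ)‖ := by
        rw [Metric.mem_ball, not_lt] at hyb
        rw [Metric.mem_ball] at hz
        rw [← dist_eq_norm]
        linarith [dist_triangle_left (y : ℂ) z₀ z]
      have hne : z ≠ (y : ℂ) := by
        rintro rfl
        simp at h1
        linarith
      rw [dslope_of_ne _ hne, slope_def_field, norm_div]
      refine div_le_div₀ (by positivity) ((norm_sub_le _ _).trans (add_le_add (hK z hz).1 ?_))
        (by positivity) h1
      rw [hρg y hy, Complex.norm_real]
      exact hM y (Ioo_subset_Icc_self hy)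

theorem integral_dslope_eq (hαβ : α ≤ β) (hc : ContinuousOn g (Icc α β))
    (hρg : ∀ y ∈ Ioo α β, ρ (y : ℂ) = g y) {z : ℂ} (hz : z.im ≠ 0) :
    ∫ y in Ioo α β, dslope ρ (y : ℂ) z =
      ρ z * (Complex.log (z - α) - Complex.log (z - β)) - densityTransform g α β z := by
  have hI : Integrable (fun y : ℝ => (z - (y : ℂ))⁻¹) (volume.restrict (Ioo α β)) := by
    have := integrable_density_div (g := fun _ => 1) (α := α) (β := β) continuousOn_const hz
    simpa using this
  rw [densityTransform, ← integral_inv_sub hαβ hz, ← integral_const_mul,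
    ← integral_sub (hI.const_mul _) (integrable_density_div hc hz)]
  refine setIntegral_congr_fun measurableSet_Ioo fun y hy => ?_
  have hne : z ≠ (y : ℂ) := by rintro rfl; simp at hz
  simp only [dslope_of_ne _ hne, slope_def_field, hρg y hy]
  ring

/-- If a density on `(α, β)` extends holomorphically to the doubly slit plane, its Cauchy transform
continues from the upper half-plane across `(α, β)`. -/
theorem exists_densityTransform_continuation (hαβ : α ≤ β) (hc : ContinuousOn g (Icc α β))
    (hρ : DifferentiableOn ℂ ρ (doubleSlitPlane α β))
    (hρg : ∀ y ∈ Ioo α β, ρ (y : ℂ) = g y) :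
    ∃ H : ℂ → ℂ, DifferentiableOn ℂ H (doubleSlitPlane α β) ∧
      (∀ z : ℂ, 0 < z.im → H z = densityTransform g α β z) ∧
      ∀ z : ℂ, z.im < 0 → H z = densityTransform g α β z - 2 * Real.pi * Complex.I * ρ z := by
  refine ⟨fun z => -(∫ y in Ioo α β, dslope ρ (y : ℂ) z) +
    ρ z * (Complex.log (z - α) - Complex.log (β - z) - Real.pi * Complex.I), ?_, fun z hz => ?_,
    fun z hz => ?_⟩
  · refine (differentiableOn_integral_dslope hc hρ hρg).neg.add (hρ.mul ?_)
    refine DifferentiableOn.sub_const (DifferentiableOn.sub ?_ ?_) _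
    · exact DifferentiableOn.clog (by fun_prop) fun z hz => sub_mem_slitPlane_of_mem hz
    · exact DifferentiableOn.clog (by fun_prop) fun z hz => sub_mem_slitPlane_of_mem' hz
  · have h : Complex.log (z - β) = Complex.log (β - z) + Real.pi * Complex.I := by
      have h1 := Complex.arg_neg_eq_arg_add_pi_of_im_neg (x := β - z) (by simpa using hz)
      rw [neg_sub] at h1
      rw [Complex.log, Complex.log, h1, norm_sub_rev]
      push_cast
      ring
    simp only [integral_dslope_eq hαβ hc hρg hz.ne', h]
    ring
  · have h : Complex.log (z - β) = Complex.log (β - z) - Real.pi * Complex.I := by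
      have h1 := Complex.arg_neg_eq_arg_sub_pi_of_im_pos (x := β - z) (by simpa using hz)
      rw [neg_sub] at h1
      rw [Complex.log, Complex.log, h1, norm_sub_rev]
      push_cast
      ring
    simp only [integral_dslope_eq hαβ hc hρg hz.ne, h]
    ring

end Continuation

/-- The principal square root of `(B - t) (t - A)`. -/
noncomputable def bulkSqrt (A B : ℝ) (t : ℂ) : ℂ := ((B - t) * (t - A)) ^ (2⁻¹ : ℂ)

section BulkSqrt

variable {A B : ℝ}

theorem bulkSqrt_sq (t : ℂ) : bulkSqrt A B t ^ 2 = (B - t) * (t - A) := by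
  rw [bulkSqrt]
  exact Complex.cpow_ofNat_inv_pow _ 2

theorem bulkSqrt_re (t : ℂ) : (bulkSqrt A B t).re =
    √((‖((B : ℂ) - t) * (t - A)‖ + (((B : ℂ) - t) * (t - A)).re) / 2) :=
  Complex.cpow_inv_two_re _

theorem bulkSqrt_re_nonneg (t : ℂ) : 0 ≤ (bulkSqrt A B t).re := by
  rw [bulkSqrt_re]
  exact Real.sqrt_nonneg _

theorem continuous_bulkSqrt_re : Continuous fun t => (bulkSqrt A B t).re := by
  simp only [bulkSqrt_re]
  have : Continuous fun t : ℂ => ((B : ℂ) - t) * (t - A) := by fun_prop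
  exact Real.continuous_sqrt.comp
    (((continuous_norm.comp this).add (Complex.continuous_re.comp this)).div_const _)

theorem norm_bulkSqrt (t : ℂ) : ‖bulkSqrt A B t‖ = √(‖((B : ℂ) - t) * (t - A)‖) := by
  rw [← bulkSqrt_sq t, norm_pow, Real.sqrt_sq (norm_nonneg _)]

theorem continuous_norm_bulkSqrt : Continuous fun t => ‖bulkSqrt A B t‖ := by
  simp only [norm_bulkSqrt]
  fun_prop

theorem norm_bulkSqrt_le (hA : 0 ≤ A) (hAB : A ≤ B) (t : ℂ) : ‖bulkSqrt A B t‖ ≤ B + ‖t‖ := by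
  have hB := hA.trans hAB
  rw [norm_bulkSqrt]
  refine Real.sqrt_le_iff.2 ⟨by positivity, ?_⟩
  rw [norm_mul, sq]
  have h1 : ‖(B : ℂ) - t‖ ≤ B + ‖t‖ := by
    refine (norm_sub_le _ _).trans ?_
    simp [abs_of_nonneg hB]
  have h2 : ‖t - (A : ℂ)‖ ≤ B + ‖t‖ := by
    refine (norm_sub_le _ _).trans ?_
    simp [abs_of_nonneg hA]
    linarith
  gcongr

theorem bulkSqrt_re_eq_zero {x : ℝ} (hAB : A ≤ B) (hx : x ∉ Ioo A B) :
    (bulkSqrt A B (x : ℂ)).re = 0 := by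
  have h : ((B : ℂ) - x) * (x - A) = (((B - x) * (x - A) : ℝ) : ℂ) := by push_cast; rfl
  have hneg : (B - x) * (x - A) ≤ 0 := by
    by_contra! h
    refine hx ⟨?_, ?_⟩ <;> by_contra! h2 <;> nlinarith
  rw [bulkSqrt_re, h, Complex.norm_real, Complex.ofReal_re, Real.norm_eq_abs, abs_of_nonpos hneg]
  simp

theorem bulk_mem_slitPlane (hAB : A < B) {t : ℂ} (ht : t ∈ doubleSlitPlane A B) :
    ((B : ℂ) - t) * (t - A) ∈ Complex.slitPlane := by
  rw [Complex.mem_slitPlane_iff]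
  simp only [Complex.mul_re, Complex.mul_im, Complex.sub_re, Complex.sub_im, Complex.ofReal_re,
    Complex.ofReal_im]
  by_contra! h
  obtain ⟨h1, h2⟩ := h
  have h3 : t.im * (A + B - 2 * t.re) = 0 := by linarith
  rcases mul_eq_zero.1 h3 with h4 | h4
  · rcases ht with h5 | h5
    · exact h5 h4
    · rw [h4] at h1
      nlinarith [mul_pos (sub_pos.2 h5.1) (sub_pos.2 h5.2)]
  · have : t.re = (A + B) / 2 := by linarith
    rw [this] at h1
    nlinarith [sq_nonneg t.im, mul_pos (sub_pos.2 hAB) (sub_pos.2 hAB)]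

theorem differentiableOn_bulkSqrt (hAB : A < B) :
    DifferentiableOn ℂ (bulkSqrt A B) (doubleSlitPlane A B) := by
  refine DifferentiableOn.cpow (by fun_prop) (by fun_prop) fun t ht => bulk_mem_slitPlane hAB ht

/-- Near the origin, the principal square root of `(B - t) (t - A)` continues holomorphically from
the lower half-plane. -/
theorem bulkSqrt_eq_of_im_neg (hAB : A < B) {t : ℂ} (ht : t.im < 0) (htA : t.re < A) :
    bulkSqrt A B t = -Complex.I * ((B - t) * (A - t)) ^ (2⁻¹ : ℂ) := by
  set w := ((B : ℂ) - t) * (A - t) with hw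
  have h1 : ((B : ℂ) - t) * (t - A) = -w := by rw [hw]; ring
  have him : 0 < w.im := by
    rw [hw]
    simp only [Complex.mul_im, Complex.sub_re, Complex.sub_im, Complex.ofReal_re,
      Complex.ofReal_im]
    nlinarith
  have hw0 : w ≠ 0 := by rintro h; simp [h] at him
  rw [bulkSqrt, h1, Complex.cpow_def_of_ne_zero (neg_ne_zero.2 hw0),
    Complex.cpow_def_of_ne_zero hw0]
  have hlog : Complex.log (-w) = Complex.log w - Real.pi * Complex.I := by
    rw [Complex.log, Complex.log, Complex.arg_neg_eq_arg_sub_pi_of_im_pos him, norm_neg]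
    push_cast
    ring
  have : Complex.exp (-(Real.pi / 2 * Complex.I)) = -Complex.I := by
    rw [Complex.exp_neg, Complex.exp_pi_div_two_mul_I, Complex.inv_I]
  rw [hlog, ← this, ← Complex.exp_add]
  congr 1
  ring

end BulkSqrt

theorem log_cpow_ofReal {z : ℂ} (hz : z ≠ 0) {a : ℝ} (h1 : -Real.pi < a * z.arg)
    (h2 : a * z.arg ≤ Real.pi) : Complex.log (z ^ (a : ℂ)) = a * Complex.log z := by
  rw [Complex.cpow_def_of_ne_zero hz, mul_comm, Complex.log_exp]
  · rwa [Complex.im_ofReal_mul, Complex.log_im]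
  · rwa [Complex.im_ofReal_mul, Complex.log_im]

theorem arg_cpow_ofReal {z : ℂ} (hz : z ≠ 0) {a : ℝ} (h1 : -Real.pi < a * z.arg)
    (h2 : a * z.arg ≤ Real.pi) : (z ^ (a : ℂ)).arg = a * z.arg := by
  rw [← Complex.log_im, log_cpow_ofReal hz h1 h2, Complex.im_ofReal_mul, Complex.log_im]

theorem cpow_cpow_ofReal {z : ℂ} {a : ℝ} (h1 : -Real.pi < a * z.arg)
    (h2 : a * z.arg ≤ Real.pi) (b : ℝ) :
    (z ^ (a : ℂ)) ^ (b : ℂ) = z ^ ((a * b : ℝ) : ℂ) := by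
  rw [Complex.ofReal_mul, Complex.cpow_mul]
  · rwa [mul_comm, Complex.im_ofReal_mul, Complex.log_im]
  · rwa [mul_comm, Complex.im_ofReal_mul, Complex.log_im]

theorem cpow_ofReal_im_neg {z : ℂ} (hz : z.im < 0) {a : ℝ} (ha : 0 < a)
    (h : -Real.pi < a * z.arg) : (z ^ (a : ℂ)).im < 0 := by
  have hz0 : z ≠ 0 := by rintro rfl; simp at hz
  have h1 : a * z.arg < 0 := mul_neg_of_pos_of_neg ha (Complex.arg_neg_iff.2 hz)
  rw [← Complex.arg_neg_iff, arg_cpow_ofReal hz0 h (h1.le.trans Real.pi_pos.le)]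
  exact h1

theorem neg_pi_lt_mul_arg {a : ℝ} (ha : 0 ≤ a) (ha1 : a ≤ 1) (z : ℂ) :
    -Real.pi < a * z.arg ∧ a * z.arg ≤ Real.pi := by
  have h1 := Complex.neg_pi_lt_arg z
  have h2 := Complex.arg_le_pi z
  constructor <;> nlinarith [Real.pi_pos]

theorem cpow_ofReal_im_ne_zero {z : ℂ} (hz : z.im ≠ 0) {a : ℝ} (ha : 0 < a) (ha1 : a ≤ 1) :
    (z ^ (a : ℂ)).im ≠ 0 := by
  have hz0 : z ≠ 0 := by rintro rfl; simp at hz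
  have harg := arg_cpow_ofReal hz0 (neg_pi_lt_mul_arg ha.le ha1 z).1
    (neg_pi_lt_mul_arg ha.le ha1 z).2
  intro h
  rcases le_or_gt 0 (z ^ (a : ℂ)).re with h1 | h1
  · rw [Complex.arg_eq_zero_iff.2 ⟨h1, h⟩, eq_comm, mul_eq_zero] at harg
    exact hz (Complex.arg_eq_zero_iff.1 (harg.resolve_left ha.ne')).2
  · rw [Complex.arg_eq_pi_iff.2 ⟨h1, h⟩] at harg
    have : z.arg = Real.pi := le_antisymm (Complex.arg_le_pi z) (by
      nlinarith [Real.pi_pos, Complex.arg_le_pi z])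
    exact hz (Complex.arg_eq_pi_iff.1 this).2

theorem mem_slitPlane_of_mem_doubleSlitPlane {α β : ℝ} (hα : 0 ≤ α) {z : ℂ}
    (hz : z ∈ doubleSlitPlane α β) : z ∈ Complex.slitPlane :=
  Complex.mem_slitPlane_iff.2 (hz.elim Or.inr fun h => Or.inl (hα.trans_lt h.1))

theorem cpow_mem_doubleSlitPlane {A B s : ℝ} (hA : 0 ≤ A) (hB : 0 ≤ B) (hs : 1 ≤ s) {z : ℂ}
    (hz : z ∈ doubleSlitPlane (A ^ s) (B ^ s)) :
    z ^ ((s⁻¹ : ℝ) : ℂ) ∈ doubleSlitPlane A B := by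
  have hs0 : 0 < s := one_pos.trans_le hs
  by_cases him : z.im = 0
  · obtain ⟨h1, h2⟩ := hz.resolve_left (not_not.2 him)
    have h0 : 0 < z.re := (Real.rpow_nonneg hA s).trans_lt h1
    have hzr : z = (z.re : ℂ) := Complex.ext rfl (by simpa using him)
    rw [hzr, ← Complex.ofReal_cpow h0.le]
    refine ofReal_mem_doubleSlitPlane ⟨?_, ?_⟩
    · exact (Real.lt_rpow_inv_iff_of_pos hA h0.le hs0).2 h1
    · exact (Real.rpow_inv_lt_iff_of_pos h0.le hB hs0).2 h2
  · exact Or.inl (cpow_ofReal_im_ne_zero him (by positivity) (inv_le_one_of_one_le₀ hs))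

/-- The holomorphic extension of the density of the law of a power. -/
noncomputable def powerDensity (A B C s κ : ℝ) (z : ℂ) : ℂ :=
  C * bulkSqrt A B (z ^ ((s⁻¹ : ℝ) : ℂ)) / z ^ (κ : ℂ)

/-- The density of the law of a power. -/
noncomputable def realPowerDensity (A B C s κ : ℝ) (y : ℝ) : ℝ :=
  C * √((B - y ^ s⁻¹) * (y ^ s⁻¹ - A)) / y ^ κ

section PowerDensity

variable {A B C s κ : ℝ}

theorem differentiableOn_powerDensity (hA : 0 ≤ A) (hAB : A < B) (hs : 1 ≤ s) :
    DifferentiableOn ℂ (powerDensity A B C s κ) (doubleSlitPlane (A ^ s) (B ^ s)) := by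
  have hslit : ∀ z ∈ doubleSlitPlane (A ^ s) (B ^ s), z ∈ Complex.slitPlane := fun z hz =>
    mem_slitPlane_of_mem_doubleSlitPlane (Real.rpow_nonneg hA s) hz
  have hpow : ∀ a : ℝ, DifferentiableOn ℂ (fun z : ℂ => z ^ (a : ℂ))
      (doubleSlitPlane (A ^ s) (B ^ s)) := fun a =>
    DifferentiableOn.cpow (by fun_prop) (by fun_prop) hslit
  refine DifferentiableOn.div ((differentiableOn_const _).mul
    ((differentiableOn_bulkSqrt hAB).comp (hpow _) fun z hz =>
      cpow_mem_doubleSlitPlane hA (hA.trans hAB.le) hs hz)) (hpow κ) fun z hz h => ?_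
  exact Complex.slitPlane_ne_zero (hslit z hz) (Complex.cpow_eq_zero_iff _ _ |>.1 h).1

theorem rpow_inv_mem_Ioo (hA : 0 ≤ A) (hB : 0 ≤ B) (hs : 0 < s) {y : ℝ}
    (hy : y ∈ Ioo (A ^ s) (B ^ s)) : y ^ s⁻¹ ∈ Ioo A B := by
  have h0 : 0 < y := (Real.rpow_nonneg hA s).trans_lt hy.1
  exact ⟨(Real.lt_rpow_inv_iff_of_pos hA h0.le hs).2 hy.1,
    (Real.rpow_inv_lt_iff_of_pos h0.le hB hs).2 hy.2⟩

theorem powerDensity_ofReal (hA : 0 ≤ A) (hB : 0 ≤ B) (hs : 0 < s) {y : ℝ}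
    (hy : y ∈ Ioo (A ^ s) (B ^ s)) :
    powerDensity A B C s κ y = realPowerDensity A B C s κ y := by
  have h0 : 0 < y := (Real.rpow_nonneg hA s).trans_lt hy.1
  obtain ⟨h1, h2⟩ := rpow_inv_mem_Ioo hA hB hs hy
  have hq : 0 ≤ (B - y ^ s⁻¹) * (y ^ s⁻¹ - A) := mul_nonneg (by linarith) (by linarith)
  rw [powerDensity, realPowerDensity, bulkSqrt, ← Complex.ofReal_cpow h0.le,
    ← Complex.ofReal_cpow h0.le, Real.sqrt_eq_rpow]
  push_cast [Complex.ofReal_cpow hq]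
  norm_num

theorem realPowerDensity_pos (hA : 0 ≤ A) (hB : 0 ≤ B) (hC : 0 < C) (hs : 0 < s) {y : ℝ}
    (hy : y ∈ Ioo (A ^ s) (B ^ s)) : 0 < realPowerDensity A B C s κ y := by
  have h0 : 0 < y := (Real.rpow_nonneg hA s).trans_lt hy.1
  obtain ⟨h1, h2⟩ := rpow_inv_mem_Ioo hA hB hs hy
  have hq : 0 < (B - y ^ s⁻¹) * (y ^ s⁻¹ - A) := mul_pos (by linarith) (by linarith)
  rw [realPowerDensity]
  positivity

theorem continuousOn_realPowerDensity (hA : 0 < A) :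
    ContinuousOn (realPowerDensity A B C s κ) (Icc (A ^ s) (B ^ s)) := by
  have h0 : ∀ y ∈ Icc (A ^ s) (B ^ s), y ≠ 0 := fun y hy =>
    ((Real.rpow_pos_of_pos hA s).trans_le hy.1).ne'
  have hpow : ∀ a : ℝ, ContinuousOn (fun y : ℝ => y ^ a) (Icc (A ^ s) (B ^ s)) := fun a =>
    continuousOn_id.rpow_const fun y hy => Or.inl (h0 y hy)
  refine ContinuousOn.div (continuousOn_const.mul (Real.continuous_sqrt.comp_continuousOn
    ((continuousOn_const.sub (hpow _)).mul ((hpow _).sub continuousOn_const)))) (hpow κ)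
    fun y hy => (Real.rpow_pos_of_pos ((Real.rpow_pos_of_pos hA s).trans_le hy.1) κ).ne'

theorem realPowerDensity_left (hA : 0 ≤ A) (hs : s ≠ 0) :
    realPowerDensity A B C s κ (A ^ s) = 0 := by
  simp [realPowerDensity, Real.rpow_rpow_inv hA hs]

theorem realPowerDensity_right (hB : 0 ≤ B) (hs : s ≠ 0) :
    realPowerDensity A B C s κ (B ^ s) = 0 := by
  simp [realPowerDensity, Real.rpow_rpow_inv hB hs]

end PowerDensity

/-- The part of the doubly slit plane lying in the sector `κ * arg z > -π`. -/
def sectorDomain (α β κ : ℝ) : Set ℂ := doubleSlitPlane α β ∩ {z | -Real.pi < κ * z.arg}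

theorem isOpen_sectorDomain {α : ℝ} (hα : 0 ≤ α) (β κ : ℝ) : IsOpen (sectorDomain α β κ) := by
  refine ContinuousOn.isOpen_inter_preimage (f := fun z : ℂ => κ * z.arg) (t := Ioi (-Real.pi))
    (fun z hz => ?_) (isOpen_doubleSlitPlane α β) isOpen_Ioi
  exact ((Complex.continuousAt_arg
    (mem_slitPlane_of_mem_doubleSlitPlane hα hz)).const_mul κ).continuousWithinAt

theorem exp_im_ne_zero_of_abs_im_lt {w : ℂ} (h0 : w.im ≠ 0) (h1 : -Real.pi < w.im)
    (h2 : w.im < Real.pi) : (Complex.exp w).im ≠ 0 := by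
  rw [Complex.exp_im]
  refine mul_ne_zero (Real.exp_pos _).ne' fun h => ?_
  exact h0 ((Real.sin_eq_zero_iff_of_lt_of_lt h1 h2).1 h)

theorem sectorDomain_eq_image_exp {α β κ : ℝ} (hα : 0 < α) (hβ : 0 < β) (hκ : 1 ≤ κ) :
    sectorDomain α β κ = Complex.exp '' {w | (w.im ≠ 0 ∨ (Real.log α < w.re ∧ w.re < Real.log β)) ∧
      -Real.pi < κ * w.im ∧ w.im < Real.pi} := by
  have hκ0 : 0 < κ := one_pos.trans_le hκ
  ext z
  constructor
  · rintro ⟨hz, harg⟩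
    have hs := mem_slitPlane_of_mem_doubleSlitPlane hα.le hz
    have hz0 := Complex.slitPlane_ne_zero hs
    refine ⟨Complex.log z, ⟨?_, ?_, ?_⟩, Complex.exp_log hz0⟩
    · by_cases him : z.im = 0
      · right
        obtain ⟨h1, h2⟩ := hz.resolve_left (not_not.2 him)
        have h0 : 0 < z.re := hα.trans h1
        have hn : ‖z‖ = z.re := by
          rw [show z = (z.re : ℂ) from Complex.ext rfl (by simpa using him), Complex.norm_real]
          simp [abs_of_pos h0]
        rw [Complex.log_re, hn]
        exact ⟨Real.log_lt_log hα h1, Real.log_lt_log h0 h2⟩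
      · left
        rw [Complex.log_im]
        exact fun h => him (Complex.arg_eq_zero_iff.1 h).2
    · rwa [Complex.log_im]
    · rw [Complex.log_im]
      exact lt_of_le_of_ne (Complex.arg_le_pi z) (Complex.mem_slitPlane_iff_arg.1 hs).1
  · rintro ⟨w, ⟨h1, h2, h3⟩, rfl⟩
    have h4 : -Real.pi < w.im := by
      by_contra! h
      nlinarith [Real.pi_pos]
    have harg : (Complex.exp w).arg = w.im := by
      rw [← Complex.log_im, Complex.log_exp h4 h3.le]
    refine ⟨?_, by simpa only [mem_ofPred_eq, harg] using h2⟩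
    by_cases him : w.im = 0
    · obtain ⟨h5, h6⟩ := h1.resolve_left (not_not.2 him)
      refine Or.inr ?_
      rw [Complex.exp_re, him, Real.cos_zero, mul_one]
      exact ⟨(Real.log_lt_iff_lt_exp hα).1 h5, (Real.lt_log_iff_exp_lt hβ).1 h6⟩
    · exact Or.inl (exp_im_ne_zero_of_abs_im_lt him h4 h3)

theorem isPreconnected_sectorDomain {α β κ : ℝ} (hα : 0 < α) (hαβ : α < β) (hκ : 1 ≤ κ) :
    IsPreconnected (sectorDomain α β κ) := by
  rw [sectorDomain_eq_image_exp hα (hα.trans hαβ) hκ]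
  refine IsPreconnected.image ?_ _ Complex.continuous_exp.continuousOn
  have hlog := Real.log_lt_log hα hαβ
  set m : ℝ := (Real.log α + Real.log β) / 2
  have hm1 : Real.log α < m := by simp only [m]; linarith
  have hm2 : m < Real.log β := by simp only [m]; linarith
  refine (StarConvex.isPathConnected (a := (m : ℂ)) (fun w hw a b ha hb hab => ?_)
    (show _ ∧ _ ∧ _ from ⟨Or.inr (by simpa using ⟨hm1, hm2⟩), by simp [Real.pi_pos],
      by simp [Real.pi_pos]⟩)).isConnected.isPreconnected
  obtain ⟨h1, h2, h3⟩ := hw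
  have him : (a • (m : ℂ) + b • w).im = b * w.im := by simp
  have hre : (a • (m : ℂ) + b • w).re = a * m + b * w.re := by simp
  refine ⟨?_, ?_, ?_⟩
  · rw [him, hre]
    rcases hb.eq_or_lt with rfl | hb
    · right
      simp only [add_zero] at hab
      subst hab
      simpa using ⟨hm1, hm2⟩
    · refine h1.imp (fun h => mul_ne_zero hb.ne' h) fun h => ?_
      simpa using convex_Ioo _ _ ⟨hm1, hm2⟩ h ha hb.le hab
  · have h4 : (0 : ℝ) ∈ Ioi (-Real.pi) := by simp [Real.pi_pos]
    have := convex_Ioi (-Real.pi) h4 h2 ha hb hab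
    simp only [smul_eq_mul, mul_zero, zero_add, mem_Ioi] at this
    rw [him]
    linarith [mul_left_comm κ b w.im]
  · have := convex_Iio Real.pi (show (0 : ℝ) ∈ Iio Real.pi from Real.pi_pos) h3 ha hb hab
    rw [him]
    simpa using this

theorem im_ge_of_eventually_im_pos {H : ℂ → ℂ} {z : ℂ} (hH : ContinuousAt H z) (hz : z.im = 0)
    {a : ℝ} (h : ∀ᶠ z' in 𝓝 z, 0 < z'.im → a ≤ (H z').im) : a ≤ (H z).im := by
  have hne : (𝓝[{z : ℂ | 0 < z.im}] z).NeBot := by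
    rw [← mem_closure_iff_nhdsWithin_neBot, Complex.closure_setOfPred_lt_im]
    exact hz.ge
  have h' : ∀ᶠ z' in 𝓝[{z : ℂ | 0 < z.im}] z, a ≤ (H z').im := eventually_nhdsWithin_iff.2 h
  exact ge_of_tendsto ((Complex.continuous_im.tendsto _).comp (hH.tendsto.mono_left
    nhdsWithin_le_nhds)) h'

/-- `H` is the continuation of the Cauchy transform of `realPowerDensity A B C s κ` from the upper
half-plane across the support. -/
structure IsPowerContinuation (A B C s κ : ℝ) (H : ℂ → ℂ) : Prop where
  A_pos : 0 < A
  A_lt_B : A < B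
  C_pos : 0 < C
  one_le_s : 1 ≤ s
  one_le_κ : 1 ≤ κ
  differentiableOn : DifferentiableOn ℂ H (doubleSlitPlane (A ^ s) (B ^ s))
  eq_of_im_pos : ∀ z : ℂ, 0 < z.im →
    H z = densityTransform (realPowerDensity A B C s κ) (A ^ s) (B ^ s) z
  eq_of_im_neg : ∀ z : ℂ, z.im < 0 →
    H z = densityTransform (realPowerDensity A B C s κ) (A ^ s) (B ^ s) z -
      2 * Real.pi * Complex.I * powerDensity A B C s κ z

theorem exists_isPowerContinuation {A B C s κ : ℝ} (hA : 0 < A) (hAB : A < B) (hC : 0 < C)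
    (hs : 1 ≤ s) (hκ : 1 ≤ κ) : ∃ H, IsPowerContinuation A B C s κ H := by
  have hs0 : 0 < s := one_pos.trans_le hs
  obtain ⟨H, h1, h2, h3⟩ := exists_densityTransform_continuation
    (Real.rpow_le_rpow hA.le hAB.le hs0.le) (continuousOn_realPowerDensity hA)
    (differentiableOn_powerDensity (C := C) (κ := κ) hA.le hAB hs)
    (fun y hy => powerDensity_ofReal hA.le (hA.trans hAB).le hs0 hy)
  exact ⟨H, hA, hAB, hC, hs, hκ, h1, h2, h3⟩

theorem norm_powerDensity {A B C s κ : ℝ} (hC : 0 ≤ C) (z : ℂ) :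
    ‖powerDensity A B C s κ z‖ = C * ‖bulkSqrt A B (z ^ ((s⁻¹ : ℝ) : ℂ))‖ / ‖z‖ ^ κ := by
  rw [powerDensity, norm_div, norm_mul, Complex.norm_real, Real.norm_eq_abs, abs_of_nonneg hC,
    Complex.norm_cpow_real]

theorem norm_powerDensity_le {A B C s κ : ℝ} (hA : 0 ≤ A) (hAB : A ≤ B) (hC : 0 ≤ C) (z : ℂ) :
    ‖powerDensity A B C s κ z‖ ≤ C * (B + ‖z‖ ^ s⁻¹) / ‖z‖ ^ κ := by
  rw [norm_powerDensity hC]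
  gcongr
  refine (norm_bulkSqrt_le hA hAB _).trans ?_
  rw [Complex.norm_cpow_real]

theorem powerDensity_re_le {A B C s κ : ℝ} (hC : 0 ≤ C) (z : ℂ) :
    (powerDensity A B C s κ z).re ≤ C * (((bulkSqrt A B (z ^ ((s⁻¹ : ℝ) : ℂ))).re *
      (z ^ (κ : ℂ)).re + ‖bulkSqrt A B (z ^ ((s⁻¹ : ℝ) : ℂ))‖ * |(z ^ (κ : ℂ)).im|) /
      Complex.normSq (z ^ (κ : ℂ))) := by
  rw [powerDensity, mul_div_assoc, Complex.re_ofReal_mul, Complex.div_re, ← add_div]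
  refine mul_le_mul_of_nonneg_left (div_le_div_of_nonneg_right ?_ (Complex.normSq_nonneg _)) hC
  refine add_le_add le_rfl ((le_abs_self _).trans ?_)
  rw [abs_mul]
  gcongr
  exact Complex.abs_im_le_norm _

theorem tendsto_log_of_tendsto_arg {c : ℂ} (hc : c ≠ 0) {l : Filter ℂ} (hl : l ≤ 𝓝 c) {θ : ℝ}
    (hθ : Tendsto Complex.arg l (𝓝 θ)) :
    Tendsto Complex.log l (𝓝 (Real.log ‖c‖ + θ * Complex.I)) := by
  have h1 : Tendsto (fun z : ℂ => Real.log ‖z‖) l (𝓝 (Real.log ‖c‖)) :=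
    ((continuous_norm.tendsto c).mono_left hl).log (norm_ne_zero_iff.2 hc)
  exact ((Complex.continuous_ofReal.tendsto _).comp h1).add
    (((Complex.continuous_ofReal.tendsto _).comp hθ).mul_const _)

theorem tendsto_cpow_of_tendsto_arg {c : ℂ} (hc : c ≠ 0) {l : Filter ℂ} (hl : l ≤ 𝓝 c) {θ : ℝ}
    (hθ : Tendsto Complex.arg l (𝓝 θ)) (a : ℝ) :
    Tendsto (fun z : ℂ => z ^ (a : ℂ)) l
      (𝓝 (Complex.exp ((Real.log ‖c‖ + θ * Complex.I) * a))) := by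
  refine Tendsto.congr' ?_ ((Complex.continuous_exp.tendsto _).comp
    ((tendsto_log_of_tendsto_arg hc hl hθ).mul_const (a : ℂ)))
  filter_upwards [hl (eventually_ne_nhds hc)] with z hz
  rw [Function.comp, Complex.cpow_def_of_ne_zero hz]

theorem re_div_sq_le (x : ℂ) : x.re ^ 2 ≤ ‖x ^ 2 + 1‖ := by
  have h : x ^ 2 + 1 = (x - Complex.I) * (x + Complex.I) := by
    linear_combination Complex.I_sq
  rw [h, norm_mul, sq, ← abs_mul_abs_self]
  have h1 := Complex.abs_re_le_norm (x - Complex.I)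
  have h2 := Complex.abs_re_le_norm (x + Complex.I)
  simp only [Complex.sub_re, Complex.add_re, Complex.I_re, sub_zero, add_zero] at h1 h2
  gcongr

namespace IsPowerContinuation

variable {A B C s κ : ℝ} {H : ℂ → ℂ}

theorem s_pos (h : IsPowerContinuation A B C s κ H) : 0 < s := one_pos.trans_le h.one_le_s
theorem κ_pos (h : IsPowerContinuation A B C s κ H) : 0 < κ := one_pos.trans_le h.one_le_κ
theorem B_pos (h : IsPowerContinuation A B C s κ H) : 0 < B := h.A_pos.trans h.A_lt_B
theorem left_pos (h : IsPowerContinuation A B C s κ H) : 0 < A ^ s := Real.rpow_pos_of_pos h.A_pos s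
theorem left_lt_right (h : IsPowerContinuation A B C s κ H) :
    A ^ s < B ^ s := Real.rpow_lt_rpow h.A_pos.le h.A_lt_B h.s_pos
theorem continuousOn_density (h : IsPowerContinuation A B C s κ H) :
    ContinuousOn (realPowerDensity A B C s κ) (Icc (A ^ s) (B ^ s)) :=
  continuousOn_realPowerDensity h.A_pos
theorem density_pos (h : IsPowerContinuation A B C s κ H) :
    ∀ y ∈ Ioo (A ^ s) (B ^ s), 0 < realPowerDensity A B C s κ y := fun _ hy =>
  realPowerDensity_pos h.A_pos.le h.B_pos.le h.C_pos h.s_pos hy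

theorem im_ge_of_im_neg (h : IsPowerContinuation A B C s κ H) {z : ℂ} (hz : z.im < 0) :
    -(2 * Real.pi * (powerDensity A B C s κ z).re) ≤ (H z).im := by
  rw [h.eq_of_im_neg z hz, Complex.sub_im]
  have h1 := densityTransform_im_nonneg h.continuousOn_density h.density_pos hz
  have h2 : (2 * Real.pi * Complex.I * powerDensity A B C s κ z).im =
      2 * Real.pi * (powerDensity A B C s κ z).re := by
    rw [mul_assoc, ← Complex.ofReal_ofNat, ← Complex.ofReal_mul, Complex.im_ofReal_mul]
    simp
  rw [h2]
  linarith

theorem eventually_powerDensity_re_le_cobounded (h : IsPowerContinuation A B C s κ H)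
    {ε : ℝ} (hε : 0 < ε) :
    ∀ᶠ z in Bornology.cobounded ℂ, (powerDensity A B C s κ z).re ≤ ε := by
  by_cases hlt : s⁻¹ < κ
  · have h1 : Tendsto (fun R : ℝ => C * (B * R ^ (-κ) + R ^ (-(κ - s⁻¹)))) atTop (𝓝 0) := by
      have := (((tendsto_rpow_neg_atTop h.κ_pos).const_mul B).add
        (tendsto_rpow_neg_atTop (sub_pos.2 hlt))).const_mul C
      simpa using this
    filter_upwards [(h1.comp tendsto_norm_cobounded_atTop).eventually_lt_const hε,
      tendsto_norm_cobounded_atTop.eventually_gt_atTop 0] with z hz hz0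
    refine (Complex.re_le_norm _).trans ((norm_powerDensity_le h.A_pos.le h.A_lt_B.le
      h.C_pos.le z).trans (le_of_eq_of_le ?_ hz.le))
    simp only [Function.comp]
    rw [neg_sub, Real.rpow_sub hz0, Real.rpow_neg hz0.le]
    field_simp
  · have hs1 : s⁻¹ ≤ 1 := inv_le_one_of_one_le₀ h.one_le_s
    have hκ1 : κ = 1 := le_antisymm ((not_lt.1 hlt).trans hs1) h.one_le_κ
    have hs1 : s⁻¹ = 1 := le_antisymm hs1 (hκ1 ▸ not_lt.1 hlt)
    have hinv : Tendsto (fun z : ℂ => z⁻¹) (Bornology.cobounded ℂ) (𝓝 0) := tendsto_inv₀_cobounded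
    have hcont : Continuous fun u : ℂ => ‖-((1 - B * u) * (1 - A * u)) + 1‖ := by fun_prop
    have hlim : Tendsto (fun z : ℂ => ‖-((1 - B * z⁻¹) * (1 - A * z⁻¹)) + 1‖)
        (Bornology.cobounded ℂ) (𝓝 0) := by
      have := (hcont.tendsto 0).comp hinv
      simpa [Function.comp_def] using this
    have hε' : 0 < (ε / C) ^ 2 := by have := h.C_pos; positivity
    filter_upwards [hlim.eventually_lt_const hε',
      Bornology.eventually_ne_cobounded (0 : ℂ)] with z hz hz0
    have hx : (bulkSqrt A B z / z) ^ 2 = -((1 - B * z⁻¹) * (1 - A * z⁻¹)) := by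
      rw [div_pow, bulkSqrt_sq]
      field_simp
      ring
    have h1 := (re_div_sq_le (bulkSqrt A B z / z)).trans_lt (hx ▸ hz)
    have h2 : (bulkSqrt A B z / z).re < ε / C :=
      lt_of_pow_lt_pow_left₀ 2 (by have := h.C_pos; positivity) h1
    rw [powerDensity, hs1, hκ1, Complex.ofReal_one, Complex.cpow_one, mul_div_assoc,
      Complex.re_ofReal_mul]
    rw [lt_div_iff₀' h.C_pos] at h2
    exact h2.le

/-- Behaviour at the boundary of the sector and at the boundary of the support, approached from
the lower half-plane. -/
theorem eventually_im_ge_nhdsWithin_im_neg (h : IsPowerContinuation A B C s κ H)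
    {c : ℂ} (hc : c ≠ 0) {θ : ℝ}
    (hθ : Tendsto Complex.arg (𝓝[{z : ℂ | z.im < 0}] c) (𝓝 θ))
    (hcase : κ * θ ≤ -Real.pi ∨ θ = 0 ∧ ‖c‖ ∉ Ioo (A ^ s) (B ^ s)) {ε : ℝ} (hε : 0 < ε) :
    ∀ᶠ z in 𝓝[{z : ℂ | z.im < 0}] c, -Real.pi < κ * z.arg → -ε ≤ (H z).im := by
  have hC := h.C_pos
  rcases lt_or_ge (κ * θ) (-Real.pi) with hlt | hge
  · filter_upwards [(hθ.const_mul κ).eventually_lt_const hlt] with z hz hz'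
    exact absurd hz hz'.not_gt
  have hn : 0 < ‖c‖ := norm_pos_iff.2 hc
  have ht := tendsto_cpow_of_tendsto_arg hc nhdsWithin_le_nhds hθ s⁻¹
  have hv := tendsto_cpow_of_tendsto_arg hc nhdsWithin_le_nhds hθ κ
  set t₀ := Complex.exp ((Real.log ‖c‖ + θ * Complex.I) * (s⁻¹ : ℝ))
  set v₀ := Complex.exp ((Real.log ‖c‖ + θ * Complex.I) * κ) with hv₀
  have hv0 : Complex.normSq v₀ ≠ 0 := by
    rw [Ne, Complex.normSq_eq_zero]
    exact Complex.exp_ne_zero _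
  have hlim := (((((continuous_bulkSqrt_re (A := A) (B := B)).tendsto t₀).comp ht).mul
    ((Complex.continuous_re.tendsto v₀).comp hv)).add
    ((((continuous_norm_bulkSqrt (A := A) (B := B)).tendsto t₀).comp ht).mul
    (((Complex.continuous_im.tendsto v₀).comp hv).abs))).div
    ((Complex.continuous_normSq.tendsto v₀).comp hv) hv0
  have hvim : v₀.im = Real.exp (Real.log ‖c‖ * κ) * Real.sin (κ * θ) := by
    rw [hv₀, Complex.exp_im]
    simp [mul_comm θ]
  have hvre : v₀.re = Real.exp (Real.log ‖c‖ * κ) * Real.cos (κ * θ) := by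
    rw [hv₀, Complex.exp_re]
    simp [mul_comm θ]
  have him0 : v₀.im = 0 ∧ (bulkSqrt A B t₀).re * v₀.re ≤ 0 := by
    rcases hcase with hπ | ⟨rfl, hI⟩
    · have : κ * θ = -Real.pi := le_antisymm hπ hge
      rw [hvim, hvre, this]
      refine ⟨by simp, mul_nonpos_of_nonneg_of_nonpos (bulkSqrt_re_nonneg _) ?_⟩
      simpa using (Real.exp_pos _).le
    · refine ⟨by rw [hvim]; simp, ?_⟩
      have : t₀ = ((‖c‖ ^ s⁻¹ : ℝ) : ℂ) := by
        simp only [t₀]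
        rw [Real.rpow_def_of_pos hn]
        push_cast
        simp
      rw [this, bulkSqrt_re_eq_zero h.A_lt_B.le, zero_mul]
      rintro ⟨h1, h2⟩
      exact hI ⟨(Real.lt_rpow_inv_iff_of_pos h.A_pos.le hn.le h.s_pos).1 h1,
        (Real.rpow_inv_lt_iff_of_pos hn.le h.B_pos.le h.s_pos).1 h2⟩
  have hle : ((bulkSqrt A B t₀).re * v₀.re + ‖bulkSqrt A B t₀‖ * |v₀.im|) / Complex.normSq v₀ <
      ε / (2 * Real.pi * C) := by
    have hpi := Real.pi_pos
    refine lt_of_le_of_lt ?_ (by positivity : 0 < ε / (2 * Real.pi * C))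
    rw [him0.1, abs_zero, mul_zero, add_zero]
    exact div_nonpos_of_nonpos_of_nonneg him0.2 (Complex.normSq_nonneg _)
  filter_upwards [hlim.eventually_lt_const hle, self_mem_nhdsWithin] with z hz hzim _
  have h1 := h.im_ge_of_im_neg hzim
  have h2 := powerDensity_re_le (A := A) (B := B) (s := s) (κ := κ) hC.le z
  have h3 := mul_le_mul_of_nonneg_left hz.le hC.le
  have h4 := h2.trans h3
  have hpi := Real.pi_pos
  have h5 : 2 * Real.pi * (C * (ε / (2 * Real.pi * C))) = ε := by field_simp
  have h6 := mul_le_mul_of_nonneg_left h4 (by positivity : 0 ≤ 2 * Real.pi)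
  linarith

theorem tendsto_norm_zero (h : IsPowerContinuation A B C s κ H) :
    Tendsto (fun z => ‖H z‖) (𝓝[{z : ℂ | z.im < 0}] 0) atTop := by
  have hC := h.C_pos
  have hpi := Real.pi_pos
  have hne : 𝓝[{z : ℂ | z.im < 0}] 0 ≤ 𝓝[≠] 0 :=
    nhdsWithin_mono _ fun z hz h0 => by
      rw [mem_singleton_iff] at h0
      simp [h0] at hz
  have hnorm : Tendsto (fun z : ℂ => ‖z‖) (𝓝[{z : ℂ | z.im < 0}] 0) (𝓝[>] 0) :=
    tendsto_norm_nhdsNE_zero.mono_left hne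
  have hrpow : ∀ {a : ℝ}, 0 < a →
      Tendsto (fun z : ℂ => ‖z‖ ^ a) (𝓝[{z : ℂ | z.im < 0}] 0) (𝓝[>] 0) := by
    intro a ha
    refine tendsto_nhdsWithin_iff.2 ⟨?_, ?_⟩
    · have := (Real.continuousAt_rpow_const 0 a (Or.inr ha.le)).tendsto.comp
        (hnorm.mono_right nhdsWithin_le_nhds)
      rwa [Real.zero_rpow ha.ne'] at this
    · filter_upwards [hnorm self_mem_nhdsWithin] with z hz
      exact Real.rpow_pos_of_pos hz a
  have ht : Tendsto (fun z : ℂ => z ^ ((s⁻¹ : ℝ) : ℂ)) (𝓝[{z : ℂ | z.im < 0}] 0) (𝓝 0) := by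
    rw [tendsto_zero_iff_norm_tendsto_zero]
    simp only [Complex.norm_cpow_real]
    exact (hrpow (inv_pos.2 h.s_pos)).mono_right nhdsWithin_le_nhds
  have hS := ((continuous_norm_bulkSqrt (A := A) (B := B)).tendsto 0).comp ht
  have hS0 : 0 < ‖bulkSqrt A B 0‖ := by
    rw [norm_bulkSqrt]
    have := h.A_pos.ne'
    have := h.B_pos.ne'
    simp
    positivity
  have hρ : Tendsto (fun z => ‖powerDensity A B C s κ z‖) (𝓝[{z : ℂ | z.im < 0}] 0) atTop := by
    simp only [norm_powerDensity hC.le]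
    exact (hS.const_mul C).pos_mul_atTop (mul_pos hC hS0)
      (tendsto_inv_nhdsGT_zero.comp (hrpow h.κ_pos))
  have hG : ContinuousAt (densityTransform (realPowerDensity A B C s κ) (A ^ s) (B ^ s)) 0 :=
    (differentiableOn_densityTransform h.left_pos h.continuousOn_density).continuousOn.continuousAt
      (Metric.ball_mem_nhds _ h.left_pos)
  have hGb := (hG.norm.eventually_lt_const (lt_add_one _)).filter_mono
    (nhdsWithin_le_nhds (s := {z : ℂ | z.im < 0}))
  have hlow := tendsto_atTop_add_const_right _
    (-(‖densityTransform (realPowerDensity A B C s κ) (A ^ s) (B ^ s) 0‖ + 1))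
    (hρ.const_mul_atTop (by positivity : 0 < 2 * Real.pi))
  refine tendsto_atTop_mono' _ ?_ hlow
  filter_upwards [hGb, self_mem_nhdsWithin] with z hz hzim
  rw [h.eq_of_im_neg z hzim, norm_sub_rev]
  have h1 := norm_sub_norm_le (2 * Real.pi * Complex.I * powerDensity A B C s κ z)
    (densityTransform (realPowerDensity A B C s κ) (A ^ s) (B ^ s) z)
  have h2 : ‖2 * Real.pi * Complex.I * powerDensity A B C s κ z‖ =
      2 * Real.pi * ‖powerDensity A B C s κ z‖ := by
    simp [abs_of_pos hpi]
  rw [h2] at h1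
  linarith

end IsPowerContinuation

namespace IsPowerContinuation

variable {A B C s κ : ℝ} {H : ℂ → ℂ}

theorem continuousAt (h : IsPowerContinuation A B C s κ H) {z : ℂ}
    (hz : z ∈ doubleSlitPlane (A ^ s) (B ^ s)) : ContinuousAt H z :=
  h.differentiableOn.continuousOn.continuousAt ((isOpen_doubleSlitPlane _ _).mem_nhds hz)

/-- A lower bound for the imaginary part on the open upper half-plane extends to the support. -/
theorem im_ge_of_im_nonneg (h : IsPowerContinuation A B C s κ H) {z : ℂ}
    (hz : z ∈ doubleSlitPlane (A ^ s) (B ^ s)) (hz0 : 0 ≤ z.im) {a : ℝ}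
    (ha : ∀ᶠ z' in 𝓝 z, 0 < z'.im →
      a ≤ (densityTransform (realPowerDensity A B C s κ) (A ^ s) (B ^ s) z').im) :
    a ≤ (H z).im := by
  have ha' : ∀ᶠ z' in 𝓝 z, 0 < z'.im → a ≤ (H z').im := by
    filter_upwards [ha] with z' hz' him
    rw [h.eq_of_im_pos z' him]
    exact hz' him
  rcases hz0.eq_or_lt with h0 | h0
  · exact im_ge_of_eventually_im_pos (h.continuousAt hz) h0.symm ha'
  · exact ha'.self_of_nhds h0

theorem eventually_im_ge_of_im_nonneg (h : IsPowerContinuation A B C s κ H) {x : ℝ}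
    (hx : x ∉ Ioo (A ^ s) (B ^ s)) {ε : ℝ} (hε : 0 < ε) :
    ∀ᶠ z : ℂ in 𝓝 (x : ℂ), z ∈ doubleSlitPlane (A ^ s) (B ^ s) → 0 ≤ z.im → -ε ≤ (H z).im := by
  have hx0 : x ∈ Icc (A ^ s) (B ^ s) → realPowerDensity A B C s κ x = 0 := by
    intro hx'
    rcases eq_endpoints_or_mem_Ioo_of_mem_Icc hx' with rfl | rfl | h'
    · exact realPowerDensity_left h.A_pos.le h.s_pos.ne'
    · exact realPowerDensity_right h.B_pos.le h.s_pos.ne'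
    · exact absurd h' hx
  filter_upwards [(eventually_densityTransform_im_ge h.left_lt_right.le h.continuousOn_density hx0
    hε).eventually_nhds] with z hz hzΩ hz0
  exact h.im_ge_of_im_nonneg hzΩ hz0 hz

theorem eventually_cobounded_im_ge_of_im_nonneg (h : IsPowerContinuation A B C s κ H) {ε : ℝ}
    (hε : 0 < ε) : ∀ᶠ z : ℂ in Bornology.cobounded ℂ, z ∈ doubleSlitPlane (A ^ s) (B ^ s) →
      0 ≤ z.im → -ε ≤ (H z).im := by
  obtain ⟨M, hM0, hM⟩ := exists_density_bound h.continuousOn_density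
  have hl : 0 < B ^ s - A ^ s := sub_pos.2 h.left_lt_right
  set d := M * (B ^ s - A ^ s) / ε
  have hd : 0 < d := by positivity
  filter_upwards [tendsto_norm_cobounded_atTop.eventually_gt_atTop (B ^ s + d)] with z hz hzΩ hz0
  refine h.im_ge_of_im_nonneg hzΩ hz0 ?_
  filter_upwards [continuous_norm.continuousAt.eventually_const_lt hz] with z' hz' _
  have hb : ∀ y ∈ Ioo (A ^ s) (B ^ s), d ≤ ‖z' - (y : ℂ)‖ := by
    intro y hy
    have h1 := norm_sub_norm_le z' (y : ℂ)
    rw [Complex.norm_real, Real.norm_eq_abs, abs_of_pos (h.left_pos.trans hy.1)] at h1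
    linarith [hy.2]
  have h2 := densityTransform_norm_le h.left_lt_right.le hM hd hb
  have h3 : M / d * (B ^ s - A ^ s) = ε := by
    simp only [d]
    field_simp
  rw [h3] at h2
  exact (abs_le.1 ((Complex.abs_im_le_norm _).trans h2)).1

theorem eventually_nhdsWithin_im_neg (h : IsPowerContinuation A B C s κ H) {c : ℂ}
    (hc : c ∉ sectorDomain (A ^ s) (B ^ s) κ) (hc0 : c.im ≤ 0) {ε : ℝ} (hε : 0 < ε) (R : ℝ) :
    ∀ᶠ z in 𝓝[{z : ℂ | z.im < 0}] c, -Real.pi < κ * z.arg → -ε ≤ (H z).im ∨ R ≤ ‖H z‖ := by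
  rcases hc0.lt_or_eq with him | him
  · have hcs : c ∈ Complex.slitPlane := Complex.mem_slitPlane_iff.2 (Or.inr him.ne)
    have hθ : Tendsto Complex.arg (𝓝[{z : ℂ | z.im < 0}] c) (𝓝 c.arg) :=
      (Complex.continuousAt_arg hcs).tendsto.mono_left nhdsWithin_le_nhds
    have hκ : κ * c.arg ≤ -Real.pi := not_lt.1 fun h' => hc ⟨Or.inl him.ne, h'⟩
    filter_upwards [h.eventually_im_ge_nhdsWithin_im_neg (Complex.slitPlane_ne_zero hcs) hθ
      (Or.inl hκ) hε] with z hz hz'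
    exact Or.inl (hz hz')
  · have hcr : c = (c.re : ℂ) := Complex.ext rfl (by simpa using him)
    rcases lt_trichotomy c.re 0 with hre | hre | hre
    · have hc0 : c ≠ 0 := by rintro rfl; simp at hre
      have hκ : κ * (-Real.pi) ≤ -Real.pi := by nlinarith [Real.pi_pos, h.one_le_κ]
      filter_upwards [h.eventually_im_ge_nhdsWithin_im_neg hc0
        (Complex.tendsto_arg_nhdsWithin_im_neg_of_re_neg_of_im_zero hre him)
        (Or.inl hκ) hε] with z hz hz'
      exact Or.inl (hz hz')
    · rw [hre, Complex.ofReal_zero] at hcr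
      subst hcr
      filter_upwards [h.tendsto_norm_zero.eventually_ge_atTop R] with z hz _ using Or.inr hz
    · have hc0 : c ≠ 0 := by rintro rfl; simp at hre
      have harg : c.arg = 0 := Complex.arg_eq_zero_iff.2 ⟨hre.le, him⟩
      have hcs : c ∈ Complex.slitPlane := Complex.mem_slitPlane_iff.2 (Or.inl hre)
      have hθ : Tendsto Complex.arg (𝓝[{z : ℂ | z.im < 0}] c) (𝓝 0) :=
        harg ▸ (Complex.continuousAt_arg hcs).tendsto.mono_left nhdsWithin_le_nhds
      have hI : ‖c‖ ∉ Ioo (A ^ s) (B ^ s) := by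
        rw [hcr, Complex.norm_real, Real.norm_eq_abs, abs_of_pos hre]
        refine fun hI => hc ⟨Or.inr hI, ?_⟩
        simp [harg, Real.pi_pos]
      filter_upwards [h.eventually_im_ge_nhdsWithin_im_neg hc0 hθ (Or.inr ⟨rfl, hI⟩) hε]
        with z hz hz'
      exact Or.inl (hz hz')

theorem eventually_nhds_of_notMem (h : IsPowerContinuation A B C s κ H) {c : ℂ}
    (hc : c ∉ sectorDomain (A ^ s) (B ^ s) κ) {ε : ℝ} (hε : 0 < ε) (R : ℝ) :
    ∀ᶠ z in 𝓝 c, z ∈ sectorDomain (A ^ s) (B ^ s) κ → -ε ≤ (H z).im ∨ R ≤ ‖H z‖ := by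
  have harg0 : ∀ z : ℂ, 0 ≤ z.im → -Real.pi < κ * z.arg := fun z hz =>
    (neg_lt_zero.2 Real.pi_pos).trans_le (mul_nonneg h.κ_pos.le (Complex.arg_nonneg_iff.2 hz))
  have hc0 : c.im ≤ 0 := by
    by_contra! h0
    exact hc ⟨Or.inl h0.ne', harg0 c h0.le⟩
  have hlow := eventually_nhdsWithin_iff.1 (h.eventually_nhdsWithin_im_neg hc hc0 hε R)
  have hup : ∀ᶠ z in 𝓝 c, z ∈ doubleSlitPlane (A ^ s) (B ^ s) → 0 ≤ z.im → -ε ≤ (H z).im := by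
    rcases hc0.lt_or_eq with him | him
    · filter_upwards [Complex.continuous_im.continuousAt.eventually_lt_const him] with z hz _ hz0
      exact absurd hz0 hz.not_ge
    · have hcr : c = (c.re : ℂ) := Complex.ext rfl (by simpa using him)
      have hx : c.re ∉ Ioo (A ^ s) (B ^ s) := fun hI => hc ⟨Or.inr hI, harg0 c him.ge⟩
      have := h.eventually_im_ge_of_im_nonneg hx hε
      rwa [← hcr] at this
  filter_upwards [hlow, hup] with z h1 h2 hz
  rcases lt_or_ge z.im 0 with h0 | h0
  · exact h1 h0 hz.2
  · exact Or.inl (h2 hz.1 h0)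

theorem eventually_cobounded (h : IsPowerContinuation A B C s κ H) {ε : ℝ} (hε : 0 < ε) :
    ∀ᶠ z in Bornology.cobounded ℂ, z ∈ sectorDomain (A ^ s) (B ^ s) κ → -ε ≤ (H z).im := by
  have hpi := Real.pi_pos
  filter_upwards [h.eventually_cobounded_im_ge_of_im_nonneg hε,
    h.eventually_powerDensity_re_le_cobounded (by positivity : 0 < ε / (2 * Real.pi))]
    with z h1 h2 hz
  rcases lt_or_ge z.im 0 with h0 | h0
  · have h3 := h.im_ge_of_im_neg h0
    rw [le_div_iff₀' (by positivity)] at h2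
    linarith
  · exact h1 hz.1 h0

/-- The continued Cauchy transform is proper over the lower half-plane. -/
theorem exists_mem_le_nhds (h : IsPowerContinuation A B C s κ H) {U : Ultrafilter ℂ}
    (hU : sectorDomain (A ^ s) (B ^ s) κ ∈ U) {w : ℂ} (hw : w.im < 0)
    (hT : Tendsto H U (𝓝 w)) :
    ∃ c ∈ sectorDomain (A ^ s) (B ^ s) κ, (U : Filter ℂ) ≤ 𝓝 c := by
  by_contra! hcon
  have hε : 0 < -w.im / 2 := by linarith
  have key : ∀ᶠ z in (U : Filter ℂ), z ∈ sectorDomain (A ^ s) (B ^ s) κ →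
      -(-w.im / 2) ≤ (H z).im ∨ ‖w‖ + 1 ≤ ‖H z‖ := by
    by_cases hb : ∃ R, Metric.closedBall (0 : ℂ) R ∈ U
    · obtain ⟨R, hR⟩ := hb
      obtain ⟨c, -, hc⟩ := (isCompact_closedBall (0 : ℂ) R).ultrafilter_le_nhds' U hR
      exact hc (h.eventually_nhds_of_notMem (fun hcD => hcon c hcD hc) hε _)
    · have hle : (U : Filter ℂ) ≤ Bornology.cobounded ℂ := by
        intro S hS
        by_contra hSU
        obtain ⟨R, hR⟩ := (Metric.isBounded_iff_subset_closedBall (0 : ℂ)).1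
          (Bornology.isBounded_def.2 (by rwa [compl_compl] : Sᶜᶜ ∈ Bornology.cobounded ℂ))
        exact hb ⟨R, mem_of_superset (Ultrafilter.compl_mem_iff_notMem.2 hSU) hR⟩
      filter_upwards [hle (h.eventually_cobounded hε)] with z hz hzD using Or.inl (hz hzD)
  have h1 := ((Complex.continuous_im.tendsto w).comp hT).eventually_lt_const
    (by linarith : w.im < -(-w.im / 2))
  have h2 := hT.norm.eventually_lt_const (lt_add_one ‖w‖)
  obtain ⟨z, hz1, hz2, hz3, hzD⟩ := (key.and (h1.and (h2.and hU))).exists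
  rcases hz1 hzD with h3 | h3
  · exact h3.not_gt hz2
  · exact h3.not_gt hz3

end IsPowerContinuation

/-- `u` tends to `c` at the origin from the lower half-plane, with `u' (v) = o(1 / v)`. -/
structure IsAsympConst (u : ℂ → ℂ) (c : ℂ) : Prop where
  differentiableAt : ∀ᶠ v in 𝓝[{v : ℂ | v.im < 0}] 0, DifferentiableAt ℂ u v
  tendsto : Tendsto u (𝓝[{v : ℂ | v.im < 0}] 0) (𝓝 c)
  tendsto_mul_deriv : Tendsto (fun v => v * deriv u v) (𝓝[{v : ℂ | v.im < 0}] 0) (𝓝 0)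

theorem tendsto_id_nhdsWithin_im_neg :
    Tendsto (fun v : ℂ => v) (𝓝[{v : ℂ | v.im < 0}] 0) (𝓝 0) :=
  tendsto_id.mono_left nhdsWithin_le_nhds

theorem isAsympConst_id : IsAsympConst (fun v => v) 0 where
  differentiableAt := Eventually.of_forall fun _ => differentiableAt_id
  tendsto := tendsto_id_nhdsWithin_im_neg
  tendsto_mul_deriv := by simpa using tendsto_id_nhdsWithin_im_neg

theorem isAsympConst_const (c : ℂ) : IsAsympConst (fun _ => c) c where
  differentiableAt := Eventually.of_forall fun _ => differentiableAt_const c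
  tendsto := tendsto_const_nhds
  tendsto_mul_deriv := by simpa using tendsto_const_nhds

theorem IsAsympConst.add {u₁ u₂ : ℂ → ℂ} {c₁ c₂ : ℂ} (h₁ : IsAsympConst u₁ c₁)
    (h₂ : IsAsympConst u₂ c₂) : IsAsympConst (fun v => u₁ v + u₂ v) (c₁ + c₂) where
  differentiableAt := by
    filter_upwards [h₁.differentiableAt, h₂.differentiableAt] with v d₁ d₂ using d₁.add d₂
  tendsto := h₁.tendsto.add h₂.tendsto
  tendsto_mul_deriv := by
    have := h₁.tendsto_mul_deriv.add h₂.tendsto_mul_deriv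
    rw [add_zero] at this
    refine this.congr' ?_
    filter_upwards [h₁.differentiableAt, h₂.differentiableAt] with v d₁ d₂
    rw [deriv_fun_add d₁ d₂, mul_add]

theorem IsAsympConst.mul {u₁ u₂ : ℂ → ℂ} {c₁ c₂ : ℂ} (h₁ : IsAsympConst u₁ c₁)
    (h₂ : IsAsympConst u₂ c₂) : IsAsympConst (fun v => u₁ v * u₂ v) (c₁ * c₂) where
  differentiableAt := by
    filter_upwards [h₁.differentiableAt, h₂.differentiableAt] with v d₁ d₂ using d₁.mul d₂
  tendsto := h₁.tendsto.mul h₂.tendsto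
  tendsto_mul_deriv := by
    have := (h₁.tendsto_mul_deriv.mul h₂.tendsto).add (h₁.tendsto.mul h₂.tendsto_mul_deriv)
    rw [zero_mul, mul_zero, add_zero] at this
    refine this.congr' ?_
    filter_upwards [h₁.differentiableAt, h₂.differentiableAt] with v d₁ d₂
    rw [deriv_fun_mul d₁ d₂]
    ring

theorem isAsympConst_comp_cpow {f : ℂ → ℂ} (hf : AnalyticAt ℂ f 0) {a : ℝ} (ha : 0 < a) :
    IsAsympConst (fun v => f (v ^ (a : ℂ))) (f 0) := by
  have hpow : Tendsto (fun v : ℂ => v ^ (a : ℂ)) (𝓝[{v : ℂ | v.im < 0}] 0) (𝓝 0) := by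
    rw [tendsto_zero_iff_norm_tendsto_zero]
    simp only [Complex.norm_cpow_real]
    have := (Real.continuousAt_rpow_const 0 a (Or.inr ha.le)).tendsto.comp
      (tendsto_norm_zero.comp tendsto_id_nhdsWithin_im_neg)
    rwa [Real.zero_rpow ha.ne'] at this
  have hder : ∀ᶠ v : ℂ in 𝓝[{v : ℂ | v.im < 0}] 0, HasDerivAt (fun v => f (v ^ (a : ℂ)))
      (deriv f (v ^ (a : ℂ)) * (a * v ^ ((a : ℂ) - 1))) v := by
    filter_upwards [hpow.eventually hf.eventually_analyticAt, self_mem_nhdsWithin] with v hv him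
    have hs : v ∈ Complex.slitPlane := Complex.mem_slitPlane_iff.2 (Or.inr (ne_of_lt him))
    have h1 : HasDerivAt (fun v : ℂ => v ^ (a : ℂ)) (a * v ^ ((a : ℂ) - 1)) v := by
      simpa using (hasDerivAt_id v).cpow_const (c := (a : ℂ)) hs
    exact hv.differentiableAt.hasDerivAt.comp v h1
  refine ⟨hder.mono fun v hv => hv.differentiableAt, hf.continuousAt.tendsto.comp hpow, ?_⟩
  have hlim := ((hf.deriv.continuousAt.tendsto.comp hpow).mul (hpow.const_mul (a : ℂ)))
  rw [mul_zero, mul_zero] at hlim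
  refine hlim.congr' ?_
  filter_upwards [hder, self_mem_nhdsWithin] with v hv him
  have hv0 : v ≠ 0 := by
    rintro rfl
    simp at him
  rw [hv.deriv, Complex.cpow_sub _ _ hv0, Complex.cpow_one]
  simp only [Function.comp]
  field_simp

/-- The quotient `u v / v` is injective near the origin in the lower half-plane. -/
theorem IsAsympConst.exists_injOn_div {u : ℂ → ℂ} {c : ℂ} (h : IsAsympConst u c) (hc : c ≠ 0) :
    ∃ δ > 0, InjOn (fun v => u v / v) ({v : ℂ | v.im < 0} ∩ Metric.ball 0 δ) := by
  have hlim : Tendsto (fun v => (u v - v * deriv u v) / u v ^ 2 - c⁻¹)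
      (𝓝[{v : ℂ | v.im < 0}] 0) (𝓝 0) := by
    have := ((h.tendsto.sub h.tendsto_mul_deriv).div (h.tendsto.pow 2)
      (pow_ne_zero 2 hc)).sub_const c⁻¹
    have e : (c - 0) / c ^ 2 - c⁻¹ = 0 := by field_simp; ring
    rwa [e] at this
  have hn : 0 < ‖c⁻¹‖ := norm_pos_iff.2 (inv_ne_zero hc)
  have hsmall := hlim.norm.eventually_lt_const (show ‖(0 : ℂ)‖ < ‖c⁻¹‖ / 2 by simpa using hc)
  obtain ⟨δ, hδ, hδ'⟩ := Metric.mem_nhdsWithin_iff.1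
    (hsmall.and (h.differentiableAt.and (h.tendsto.eventually_ne hc)))
  refine ⟨δ, hδ, ?_⟩
  have hder : ∀ v ∈ {v : ℂ | v.im < 0} ∩ Metric.ball 0 δ,
      HasDerivAt (fun v => v / u v - c⁻¹ * v) ((u v - v * deriv u v) / u v ^ 2 - c⁻¹) v := by
    rintro v ⟨hv, hvb⟩
    obtain ⟨-, h2, h3⟩ := hδ' ⟨hvb, hv⟩
    have h4 := ((hasDerivAt_id v).div h2.hasDerivAt h3).sub ((hasDerivAt_id v).const_mul c⁻¹)
    convert! h4 using 1
    simp
  have hconv : Convex ℝ ({v : ℂ | v.im < 0} ∩ Metric.ball 0 δ) :=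
    (convex_halfSpace_im_lt 0).inter (convex_ball _ _)
  intro v₁ h₁ v₂ h₂ heq
  have hmv := hconv.norm_image_sub_le_of_norm_hasDerivWithin_le (C := ‖c⁻¹‖ / 2)
    (fun v hv => (hder v hv).hasDerivWithinAt) (fun v hv => (hδ' ⟨hv.2, hv.1⟩).1.le) h₁ h₂
  have heq' : v₁ / u v₁ = v₂ / u v₂ := by
    rw [← inv_div, ← inv_div (u v₂)]
    exact congrArg _ heq
  have e : v₂ / u v₂ - c⁻¹ * v₂ - (v₁ / u v₁ - c⁻¹ * v₁) = -(c⁻¹ * (v₂ - v₁)) := by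
    rw [heq']; ring
  rw [e, norm_neg, norm_mul] at hmv
  by_contra hne
  have : 0 < ‖v₂ - v₁‖ := norm_pos_iff.2 (sub_ne_zero.2 (Ne.symm hne))
  nlinarith

namespace IsPowerContinuation

variable {A B C s κ : ℝ} {H : ℂ → ℂ}

/-- In the coordinate `v = z ^ κ`, the product `v * H z` is asymptotically constant at the
origin. -/
theorem exists_eq_div (h : IsPowerContinuation A B C s κ H) :
    ∃ u : ℂ → ℂ, ∃ c : ℂ, c ≠ 0 ∧ IsAsympConst u c ∧ ∃ δ > 0, ∀ z : ℂ, z.im < 0 →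
      -Real.pi < κ * z.arg → ‖z‖ < δ → H z = u (z ^ (κ : ℂ)) / z ^ (κ : ℂ) := by
  have hA := h.A_pos
  have hB := h.B_pos
  have hC := h.C_pos
  have hpi := Real.pi_pos
  set G := densityTransform (realPowerDensity A B C s κ) (A ^ s) (B ^ s)
  set P : ℂ → ℂ := fun t => ((B - t) * (A - t)) ^ (2⁻¹ : ℂ)
  have hP0 : ((B : ℂ) - 0) * (A - 0) ∈ Complex.slitPlane := by
    rw [sub_zero, sub_zero, ← Complex.ofReal_mul]
    exact Complex.ofReal_mem_slitPlane.2 (mul_pos hB hA)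
  have hP : AnalyticAt ℂ P 0 := AnalyticAt.cpow (by fun_prop) analyticAt_const hP0
  have hG : AnalyticAt ℂ G 0 :=
    (differentiableOn_densityTransform h.left_pos h.continuousOn_density).analyticAt
      (Metric.ball_mem_nhds _ h.left_pos)
  have hκ := h.κ_pos
  have hs := h.s_pos
  refine ⟨_, _, ?_, ((isAsympConst_const (-(2 * Real.pi * C))).mul (isAsympConst_comp_cpow hP
    (by positivity : 0 < κ⁻¹ * s⁻¹))).add (isAsympConst_id.mul (isAsympConst_comp_cpow hG
    (by positivity : 0 < κ⁻¹))), A ^ s, h.left_pos, fun z hz harg hzn => ?_⟩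
  · rw [zero_mul, add_zero]
    refine mul_ne_zero (neg_ne_zero.2 ?_) fun h0 => Complex.slitPlane_ne_zero hP0
      ((Complex.cpow_eq_zero_iff _ _).1 h0).1
    exact mul_ne_zero (mul_ne_zero two_ne_zero (Complex.ofReal_ne_zero.2 hpi.ne'))
      (Complex.ofReal_ne_zero.2 hC.ne')
  · have hz0 : z ≠ 0 := by rintro rfl; simp at hz
    have hneg : z.arg < 0 := Complex.arg_neg_iff.2 hz
    have harg2 : κ * z.arg ≤ Real.pi := (mul_neg_of_pos_of_neg hκ hneg).le.trans hpi.le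
    have e1 : (z ^ (κ : ℂ)) ^ ((κ⁻¹ : ℝ) : ℂ) = z := by
      rw [cpow_cpow_ofReal harg harg2, mul_inv_cancel₀ hκ.ne', Complex.ofReal_one,
        Complex.cpow_one]
    have e2 : (z ^ (κ : ℂ)) ^ ((κ⁻¹ * s⁻¹ : ℝ) : ℂ) = z ^ ((s⁻¹ : ℝ) : ℂ) := by
      rw [cpow_cpow_ofReal harg harg2, mul_inv_cancel_left₀ hκ.ne']
    have hv : z ^ (κ : ℂ) ≠ 0 := fun h0 => hz0 ((Complex.cpow_eq_zero_iff _ _).1 h0).1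
    have htim : (z ^ ((s⁻¹ : ℝ) : ℂ)).im < 0 :=
      cpow_ofReal_im_neg hz (inv_pos.2 hs)
        (neg_pi_lt_mul_arg (inv_pos.2 hs).le (inv_le_one_of_one_le₀ h.one_le_s) z).1
    have htre : (z ^ ((s⁻¹ : ℝ) : ℂ)).re < A := by
      refine (Complex.re_le_norm _).trans_lt ?_
      rw [Complex.norm_cpow_real]
      exact (Real.rpow_inv_lt_iff_of_pos (norm_nonneg z) hA.le hs).2 hzn
    rw [e1, e2, h.eq_of_im_neg z hz, powerDensity, bulkSqrt_eq_of_im_neg h.A_lt_B htim htre]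
    simp only [P]
    generalize (((B : ℂ) - z ^ ((s⁻¹ : ℝ) : ℂ)) * (A - z ^ ((s⁻¹ : ℝ) : ℂ))) ^ (2⁻¹ : ℂ) = q
    generalize z ^ (κ : ℂ) = v at hv
    field_simp
    linear_combination (2 * Real.pi * C * q) * Complex.I_sq

theorem exists_norm_lt (h : IsPowerContinuation A B C s κ H) {δ : ℝ} (hδ : 0 < δ) :
    ∃ R : ℝ, ∀ z ∈ doubleSlitPlane (A ^ s) (B ^ s), (H z).im < -R → z.im < 0 ∧ ‖z‖ < δ := by
  have hB := h.B_pos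
  have hC := h.C_pos
  have hpi := Real.pi_pos
  obtain ⟨M, hM0, hM⟩ := exists_density_bound h.continuousOn_density
  set K := C * (B * δ ^ (-κ) + δ ^ (s⁻¹ - κ))
  refine ⟨max (Real.pi * M) (2 * Real.pi * K), fun z hzΩ hz => ?_⟩
  have him : z.im < 0 := by
    by_contra! h0
    refine (lt_of_lt_of_le hz (neg_le_neg (le_max_left _ _))).not_ge
      (h.im_ge_of_im_nonneg hzΩ h0 (Eventually.of_forall fun z' hz' => ?_))
    have := densityTransform_im_ge h.left_lt_right.le h.continuousOn_density hM0.le le_rfl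
      (c := 0) (fun y hy => by
        simpa using (le_abs_self _).trans (hM y (Ioo_subset_Icc_self hy))) hz'
    simpa using this
  refine ⟨him, ?_⟩
  by_contra! hn
  have hz0 : 0 < ‖z‖ := hδ.trans_le hn
  have hρ : (powerDensity A B C s κ z).re ≤ K := by
    refine (Complex.re_le_norm _).trans ((norm_powerDensity_le h.A_pos.le h.A_lt_B.le
      hC.le z).trans ?_)
    have e : C * (B + ‖z‖ ^ s⁻¹) / ‖z‖ ^ κ = C * (B * ‖z‖ ^ (-κ) + ‖z‖ ^ (s⁻¹ - κ)) := by
      rw [Real.rpow_sub hz0, Real.rpow_neg hz0.le]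
      field_simp
    rw [e]
    have h1 : ‖z‖ ^ (-κ) ≤ δ ^ (-κ) :=
      Real.rpow_le_rpow_of_nonpos hδ hn (neg_nonpos.2 h.κ_pos.le)
    have h2 : ‖z‖ ^ (s⁻¹ - κ) ≤ δ ^ (s⁻¹ - κ) :=
      Real.rpow_le_rpow_of_nonpos hδ hn
        (sub_nonpos.2 ((inv_le_one_of_one_le₀ h.one_le_s).trans h.one_le_κ))
    simp only [K]
    gcongr
  have h1 := h.im_ge_of_im_neg him
  have h2 : -(2 * Real.pi * K) ≤ (H z).im := by
    refine le_trans (neg_le_neg ?_) h1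
    gcongr
  exact (lt_of_lt_of_le hz (neg_le_neg (le_max_right _ _))).not_ge h2

/-- Values far down in the lower half-plane are taken at most once. -/
theorem exists_forall_eq_of_im_lt (h : IsPowerContinuation A B C s κ H) :
    ∃ R : ℝ, ∀ z₁ ∈ sectorDomain (A ^ s) (B ^ s) κ, ∀ z₂ ∈ sectorDomain (A ^ s) (B ^ s) κ,
      (H z₁).im < -R → H z₁ = H z₂ → z₁ = z₂ := by
  have hκ := h.κ_pos
  have hpi := Real.pi_pos
  obtain ⟨u, c, hc, hu, δ₁, hδ₁, heq⟩ := h.exists_eq_div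
  obtain ⟨δ₂, hδ₂, hinj⟩ := hu.exists_injOn_div hc
  obtain ⟨R, hR⟩ := h.exists_norm_lt
    (lt_min hδ₁ (Real.rpow_pos_of_pos hδ₂ κ⁻¹))
  have key : ∀ z ∈ sectorDomain (A ^ s) (B ^ s) κ, (H z).im < -R →
      z ^ (κ : ℂ) ∈ {v : ℂ | v.im < 0} ∩ Metric.ball 0 δ₂ ∧
      H z = u (z ^ (κ : ℂ)) / z ^ (κ : ℂ) ∧ (z ^ (κ : ℂ)) ^ ((κ⁻¹ : ℝ) : ℂ) = z := by
    intro z hz hzR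
    obtain ⟨him, hn⟩ := hR z hz.1 hzR
    have hneg : z.arg < 0 := Complex.arg_neg_iff.2 him
    have harg2 : κ * z.arg ≤ Real.pi := (mul_neg_of_pos_of_neg hκ hneg).le.trans hpi.le
    refine ⟨⟨cpow_ofReal_im_neg him hκ hz.2, ?_⟩,
      heq z him hz.2 (hn.trans_le (min_le_left _ _)), ?_⟩
    · rw [mem_ball_zero_iff, Complex.norm_cpow_real]
      exact (Real.lt_rpow_inv_iff_of_pos (norm_nonneg z) hδ₂.le hκ).1
        (hn.trans_le (min_le_right _ _))
    · rw [cpow_cpow_ofReal hz.2 harg2, mul_inv_cancel₀ hκ.ne', Complex.ofReal_one,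
        Complex.cpow_one]
  refine ⟨R, fun z₁ h₁ z₂ h₂ hz heqz => ?_⟩
  obtain ⟨a₁, b₁, c₁⟩ := key z₁ h₁ hz
  obtain ⟨a₂, b₂, c₂⟩ := key z₂ h₂ (heqz ▸ hz)
  rw [b₁, b₂] at heqz
  rw [← c₁, ← c₂, hinj a₁ a₂ heqz]

end IsPowerContinuation

theorem mem_sectorDomain_of_im_pos {α β κ : ℝ} (hκ : 0 ≤ κ) {z : ℂ} (hz : 0 < z.im) :
    z ∈ sectorDomain α β κ :=
  ⟨Or.inl hz.ne', (neg_lt_zero.2 Real.pi_pos).trans_le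
    (mul_nonneg hκ (Complex.arg_nonneg_iff.2 hz.le))⟩

/-- The continuation is a bijection from a subdomain onto the lower half-plane, with analytic
inverse. -/
theorem IsPowerContinuation.exists_analytic_inverse {A B C s κ : ℝ} {H : ℂ → ℂ}
    (h : IsPowerContinuation A B C s κ H) :
    ∃ F, AnalyticOnNhd ℂ F {w : ℂ | w.im < 0} ∧ ∀ w : ℂ, w.im < 0 →
      F w ∈ sectorDomain (A ^ s) (B ^ s) κ ∧ H (F w) = w ∧
        ∀ z ∈ sectorDomain (A ^ s) (B ^ s) κ, H z = w → z = F w := by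
  obtain ⟨R, hR⟩ := h.exists_forall_eq_of_im_lt
  obtain ⟨δ, hδ, hsurj⟩ :=
    exists_densityTransform_eq h.left_pos h.left_lt_right h.continuousOn_density h.density_pos
  have hopen := isOpen_sectorDomain h.left_pos.le (B ^ s) κ
  have hsmall : ∀ t : ℝ, 0 < t → t < δ →
      ∃ z ∈ sectorDomain (A ^ s) (B ^ s) κ, H z = -(t * Complex.I) := by
    intro t ht htδ
    obtain ⟨z, hz, hzw⟩ := hsurj (-(t * Complex.I)) (by simpa [abs_of_pos ht] using htδ)
      (by simpa using ht)
    exact ⟨z, mem_sectorDomain_of_im_pos h.κ_pos.le hz, by rw [h.eq_of_im_pos z hz, hzw]⟩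
  obtain ⟨z₁, hz₁, e₁⟩ := hsmall (δ / 2) (by positivity) (by linarith)
  obtain ⟨z₂, hz₂, e₂⟩ := hsmall (δ / 3) (by positivity) (by linarith)
  refine exists_analytic_inverse_of_proper (O := {w : ℂ | w.im < -R}) hopen
    (isPreconnected_sectorDomain h.left_pos h.left_lt_right h.one_le_κ)
    ((h.differentiableOn.mono inter_subset_left).analyticOnNhd hopen)
    (isOpen_lt Complex.continuous_im continuous_const)
    (convex_halfSpace_im_lt 0).isPreconnected
    (fun U hU w hw hT => h.exists_mem_le_nhds hU hw hT)
    (isOpen_lt Complex.continuous_im continuous_const) ?_ hR ?_ ⟨z₁, hz₁, ?_⟩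
  · refine ⟨-((|R| + 1 : ℝ) * Complex.I), ?_, ?_⟩
    · simp only [mem_ofPred_eq, Complex.neg_im, Complex.im_ofReal_mul,
        Complex.I_im]
      linarith [abs_nonneg R]
    · simp only [mem_ofPred_eq, Complex.neg_im, Complex.im_ofReal_mul, Complex.I_im]
      linarith [le_abs_self R]
  · intro w
    by_contra! hw
    have := e₁.symm.trans ((hw z₁ hz₁).trans ((hw z₂ hz₂).symm.trans e₂))
    have := congrArg Complex.im this
    simp only [Complex.neg_im, Complex.im_ofReal_mul, Complex.I_im] at this
    linarith
  · rw [e₁]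
    simpa using hδ

/-- A measure with a density of the form `realPowerDensity` is in the class UI. -/
theorem isUI_of_cauchyTransform_eq {A B C s κ : ℝ} (hA : 0 < A) (hAB : A < B) (hC : 0 < C)
    (hs : 1 ≤ s) (hκ : 1 ≤ κ) {μ : Measure ℝ} (hμ : ∀ z : ℂ, 0 < z.im →
      cauchyTransform μ z = densityTransform (realPowerDensity A B C s κ) (A ^ s) (B ^ s) z) :
    IsUI μ := by
  obtain ⟨H, h⟩ := exists_isPowerContinuation hA hAB hC hs hκ
  obtain ⟨F, hF, hFH⟩ := h.exists_analytic_inverse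
  obtain ⟨δ, hδ, hsurj⟩ :=
    exists_densityTransform_eq h.left_pos h.left_lt_right h.continuousOn_density h.density_pos
  refine ⟨F, hF, fun w₁ h₁ w₂ h₂ he => ?_, 1, one_pos, δ / 2, by positivity,
    fun w hw1 hw2 => ?_⟩
  · rw [← (hFH w₁ h₁).2.1, he, (hFH w₂ h₂).2.1]
  · rw [one_mul] at hw1
    have him : w.im < 0 := neg_pos.1 ((abs_nonneg _).trans_lt hw1)
    have hn : ‖w‖ < δ := (Complex.norm_le_abs_re_add_abs_im w).trans_lt <| by
      rw [abs_of_neg him]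
      linarith
    obtain ⟨z, hz, hzw⟩ := hsurj w hn him
    rw [← (hFH w him).2.2 z (mem_sectorDomain_of_im_pos h.κ_pos.le hz)
      (by rw [h.eq_of_im_pos z hz, hzw]), hμ z hz]
    exact ⟨hz, hzw⟩

theorem measurable_fpDensity (p : ℝ) : Measurable (fpDensity p) := by
  unfold fpDensity
  fun_prop

theorem fpDensity_nonneg (p : ℝ) {x : ℝ} (hx : 0 ≤ x) : 0 ≤ fpDensity p x :=
  div_nonneg (Real.sqrt_nonneg _) (mul_nonneg (by positivity) hx)

theorem integral_fpMeasure (p : ℝ) (f : ℝ → ℂ) :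
    ∫ x, f x ∂fpMeasure p =
      ∫ x in Ioo ((√p - 1) ^ 2) ((√p + 1) ^ 2), fpDensity p x • f x := by
  rw [fpMeasure, integral_withDensity_eq_integral_toReal_smul
    ((measurable_fpDensity p).indicator measurableSet_Ioo).ennreal_ofReal
    (Eventually.of_forall fun _ => ENNReal.ofReal_lt_top), ← integral_indicator measurableSet_Ioo]
  refine integral_congr_ae (Eventually.of_forall fun x => ?_)
  by_cases hx : x ∈ Ioo ((√p - 1) ^ 2) ((√p + 1) ^ 2)
  · have h0 := fpDensity_nonneg p ((sq_nonneg _).trans hx.1.le)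
    simp [indicator_of_mem hx, ENNReal.toReal_ofReal h0]
  · simp [indicator_of_notMem hx]

/-- Change of variables for the law of a power of a free Poisson variable. -/
theorem cauchyTransform_map_rpow_fpMeasure {p r α β : ℝ} {g : ℝ → ℝ} (hr : r ≠ 0)
    (himage : (fun x : ℝ => x ^ r) '' Ioo ((√p - 1) ^ 2) ((√p + 1) ^ 2) = Ioo α β)
    (hg : ∀ x ∈ Ioo ((√p - 1) ^ 2) ((√p + 1) ^ 2), |r * x ^ (r - 1)| * g (x ^ r) = fpDensity p x)
    (z : ℂ) :
    cauchyTransform (Measure.map (fun x : ℝ => x ^ r) (fpMeasure p)) z =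
      densityTransform g α β z := by
  have hpos : ∀ x ∈ Ioo ((√p - 1) ^ 2) ((√p + 1) ^ 2), 0 < x := fun x hx =>
    (sq_nonneg _).trans_lt hx.1
  have hm : Measurable fun x : ℝ => x ^ r := by fun_prop
  have hm' : Measurable fun x : ℝ => (z - (x : ℂ))⁻¹ := by fun_prop
  rw [cauchyTransform, integral_map hm.aemeasurable hm'.aestronglyMeasurable,
    integral_fpMeasure, densityTransform, ← himage,
    integral_image_eq_integral_abs_deriv_smul measurableSet_Ioo
      (fun x hx => (Real.hasDerivAt_rpow_const (Or.inl (hpos x hx).ne')).hasDerivWithinAt)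
      (fun x hx y hy h => (Real.rpow_left_inj (hpos x hx).le (hpos y hy).le hr).1 h)]
  refine setIntegral_congr_fun measurableSet_Ioo fun x hx => ?_
  simp only [Complex.real_smul]
  rw [← hg x hx]
  push_cast
  ring

theorem image_rpow_Ioo {a b r : ℝ} (ha : 0 < a) (hb : 0 < b) (hr : 0 < r) :
    (fun x : ℝ => x ^ r) '' Ioo a b = Ioo (a ^ r) (b ^ r) := by
  ext y
  constructor
  · rintro ⟨x, ⟨h1, h2⟩, rfl⟩
    exact ⟨Real.rpow_lt_rpow ha.le h1 hr, Real.rpow_lt_rpow (ha.trans h1).le h2 hr⟩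
  · intro hy
    refine ⟨y ^ r⁻¹, rpow_inv_mem_Ioo ha.le hb.le hr hy, ?_⟩
    exact Real.rpow_inv_rpow ((Real.rpow_pos_of_pos ha r).trans hy.1).le hr.ne'

theorem image_rpow_neg_Ioo {a b r : ℝ} (ha : 0 < a) (hb : 0 < b) (hr : 0 < r) :
    (fun x : ℝ => x ^ (-r)) '' Ioo a b = Ioo (b⁻¹ ^ r) (a⁻¹ ^ r) := by
  have hneg : ∀ x : ℝ, 0 < x → x ^ (-r) = x⁻¹ ^ r := fun x hx => by
    rw [Real.rpow_neg hx.le, Real.inv_rpow hx.le]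
  rw [← image_rpow_Ioo (inv_pos.2 hb) (inv_pos.2 ha) hr]
  ext y
  constructor
  · rintro ⟨x, hx, rfl⟩
    exact ⟨x⁻¹, ⟨inv_strictAnti₀ (ha.trans hx.1) hx.2, inv_strictAnti₀ ha hx.1⟩,
      (hneg x (ha.trans hx.1)).symm⟩
  · rintro ⟨x, hx, rfl⟩
    have hx0 : 0 < x := (inv_pos.2 hb).trans hx.1
    exact ⟨x⁻¹, ⟨(lt_inv_comm₀ ha hx0).2 hx.2, (inv_lt_comm₀ hx0 hb).2 hx.1⟩,
      by simp only [hneg x⁻¹ (inv_pos.2 hx0), inv_inv]⟩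

theorem freePoisson_power_UI_of_one_le {p r : ℝ} (hp : 1 < p) (hr : 1 ≤ r) :
    IsUI (Measure.map (fun x : ℝ => x ^ r) (fpMeasure p)) := by
  have hr0 : 0 < r := one_pos.trans_le hr
  have hsqrt : 1 < √p := Real.lt_sqrt_of_sq_lt (by simpa using hp)
  have ha : 0 < (√p - 1) ^ 2 := pow_pos (sub_pos.2 hsqrt) 2
  have hab : (√p - 1) ^ 2 < (√p + 1) ^ 2 := by nlinarith
  refine isUI_of_cauchyTransform_eq (C := (2 * Real.pi * r)⁻¹) ha hab (by positivity) hr le_rfl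
    fun z _ => cauchyTransform_map_rpow_fpMeasure hr0.ne'
      (image_rpow_Ioo ha (ha.trans hab) hr0) (fun x hx => ?_) z
  have hx : 0 < x := ha.trans hx.1
  rw [realPowerDensity, fpDensity, Real.rpow_rpow_inv hx.le hr0.ne', Real.rpow_one,
    abs_of_pos (by positivity), Real.rpow_sub_one hx.ne']
  have : x ^ r ≠ 0 := by positivity
  field_simp

theorem freePoisson_power_UI_of_le_neg_one {p s : ℝ} (hp : 1 < p) (hs : 1 ≤ s) :
    IsUI (Measure.map (fun x : ℝ => x ^ (-s)) (fpMeasure p)) := by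
  have hs0 : 0 < s := one_pos.trans_le hs
  have hsqrt : 1 < √p := Real.lt_sqrt_of_sq_lt (by simpa using hp)
  have ha : 0 < (√p - 1) ^ 2 := pow_pos (sub_pos.2 hsqrt) 2
  have hab : (√p - 1) ^ 2 < (√p + 1) ^ 2 := by nlinarith
  have hb := ha.trans hab
  refine isUI_of_cauchyTransform_eq
    (C := √((√p - 1) ^ 2 * (√p + 1) ^ 2) / (2 * Real.pi * s)) (κ := 1 + s⁻¹)
    (inv_pos.2 hb) (inv_strictAnti₀ ha hab) (by positivity) hs
    (le_add_of_nonneg_right (by positivity))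
    fun z _ => cauchyTransform_map_rpow_fpMeasure (neg_ne_zero.2 hs0.ne')
      (image_rpow_neg_Ioo ha hb hs0) (fun x hx => ?_) z
  have hx0 : 0 < x := ha.trans hx.1
  have e1 : (x ^ (-s)) ^ s⁻¹ = x⁻¹ := by
    rw [← Real.rpow_mul hx0.le, neg_mul, mul_inv_cancel₀ hs0.ne', Real.rpow_neg_one]
  have e2 : (x ^ (-s)) ^ (1 + s⁻¹) = x ^ (-s) * x⁻¹ := by
    rw [Real.rpow_one_add' (by positivity) (by positivity), e1]
  have e3 : √((√p - 1) ^ 2 * (√p + 1) ^ 2) *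
      √((((√p - 1) ^ 2)⁻¹ - x⁻¹) * (x⁻¹ - ((√p + 1) ^ 2)⁻¹)) =
      √(((√p + 1) ^ 2 - x) * (x - (√p - 1) ^ 2)) / x := by
    have hsqrt_mul (y : ℝ) : √y * x = √(y * x ^ 2) := by
      rw [Real.sqrt_mul' _ (sq_nonneg x), Real.sqrt_sq hx0.le]
    rw [← Real.sqrt_mul (by positivity), eq_div_iff hx0.ne', hsqrt_mul]
    congr 1
    generalize (√p - 1) ^ 2 = a at ha
    generalize (√p + 1) ^ 2 = b at hb
    field_simp
  rw [realPowerDensity, fpDensity, e1, e2, div_mul_eq_mul_div, e3, abs_mul, abs_neg,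
    abs_of_pos hs0, abs_of_pos (by positivity), Real.rpow_sub_one hx0.ne']
  have : x ^ (-s) ≠ 0 := by positivity
  field_simp

/-- If `X ~ fp(p)` with `p > 1`, then `X^r ∈ UI` for every `r` with `|r| ≥ 1`. -/
theorem freePoisson_power_UI (p : ℝ) (hp : 1 < p) (r : ℝ) (hr : 1 ≤ |r|) :
    IsUI (Measure.map (fun x : ℝ => x ^ r) (fpMeasure p)) := by
  rcases le_abs.1 hr with h | h
  · exact freePoisson_power_UI_of_one_le hp h
  · simpa using freePoisson_power_UI_of_le_neg_one hp h
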